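/- Let V be a multiply local OPE-algebra with state–field correspondence Y. Then F_Y is closed under the products of fields, and Y is an isomorphism of OPE-algebras from V onto F_Y: Y is injective (indeed s_1∘Y = id_V), Y(1) = 1(z) = id_V, and for all a,b∈V and all 𝐧∈K², Y(a_(𝐧)b) = a(𝐳)_(𝐧)b(𝐳). -/

import Mathlib

open scoped BigOperators Classical

noncomputable section

namespace OPEA

variable (K : Type*) [Field K] [CharZero K]

/-- index pairs 𝐧 = (n, n̄) ∈ K² -/
abbrev Idx := K × K

def IsInt (x : K) : Prop := ∃ k : ℤ, (k : K) = x

def IsNegInt (x : K) : Prop := ∃ k : ℤ, k < 0 ∧ (k : K) = x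

/-- 𝕂̄ = {𝐧 ∈ K² | n − n̄ ∈ ℤ} -/
def Kbar (n : Idx K) : Prop := IsInt K (n.1 - n.2)

def IsIntPair (n : Idx K) : Prop := IsInt K n.1 ∧ IsInt K n.2

/-- generalized binomial coefficient C(x,k) -/
def gchoose (x : K) (k : ℕ) : K :=
  (∏ i ∈ Finset.range k, (x - (i : K))) / (k.factorial : K)

/-- (−1)^x for x an integer image in K (and 1 otherwise) -/
def negOnePow (x : K) : K :=
  if h : ∃ k : ℤ, (k : K) = x then (-1 : K) ^ h.choose else 1

variable (M : Type*) [AddCommGroup M] [Module K M]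

/-- M-valued distribution in one variable pair -/
abbrev Dist1 := Idx K → M

/-- M-valued distribution in two variable pairs -/
abbrev Dist2 := Idx K → Idx K → M

/-- M-valued distribution in r variable pairs -/
abbrev DistN (r : ℕ) := (Fin r → Idx K) → M

/-- membership in M[[𝐳]] -/
def IsPow1 (a : Dist1 K M) : Prop := ∀ n, a n ≠ 0 → IsNegInt K n.1 ∧ IsNegInt K n.2

/-- membership in M⌊𝐳⌋ -/
def InLat1 (a : Dist1 K M) : Prop :=
  ∃ S : Finset (Idx K), ∀ n, a n ≠ 0 →
    ∃ m ∈ S, IsNegInt K (n.1 - m.1) ∧ IsNegInt K (n.2 - m.2)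

/-- membership in M[[𝐳,𝐰]] -/
def IsPow2 (a : Dist2 K M) : Prop :=
  ∀ n k, a n k ≠ 0 →
    (IsNegInt K n.1 ∧ IsNegInt K n.2) ∧ (IsNegInt K k.1 ∧ IsNegInt K k.2)

/-- membership in M⌊𝐳,𝐰⌋ -/
def InLat2 (a : Dist2 K M) : Prop :=
  ∃ S : Finset (Idx K × Idx K), ∀ n k, a n k ≠ 0 →
    ∃ m ∈ S, (IsNegInt K (n.1 - m.1.1) ∧ IsNegInt K (n.2 - m.1.2)) ∧
      (IsNegInt K (k.1 - m.2.1) ∧ IsNegInt K (k.2 - m.2.2))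

/-- membership in M[[𝐳₁,…,𝐳ᵣ]] -/
def IsPowN {r : ℕ} (a : DistN K M r) : Prop :=
  ∀ n, a n ≠ 0 → ∀ i, IsNegInt K (n i).1 ∧ IsNegInt K (n i).2

/-- membership in M⌊𝐳₁,…,𝐳ᵣ⌋ -/
def InLatN {r : ℕ} (a : DistN K M r) : Prop :=
  ∃ S : Finset (Fin r → Idx K), ∀ n, a n ≠ 0 →
    ∃ m ∈ S, ∀ i, IsNegInt K ((n i).1 - (m i).1) ∧ IsNegInt K ((n i).2 - (m i).2)

/-- ∂_z -/
def dz (a : Dist1 K M) : Dist1 K M := fun n => (-n.1) • a (n.1 - 1, n.2)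

/-- ∂_z̄ -/
def dzb (a : Dist1 K M) : Dist1 K M := fun n => (-n.2) • a (n.1, n.2 - 1)

/-- ∂ in the first variable pair of a two-variable distribution (z-component) -/
def d1z (c : Dist2 K M) : Dist2 K M := fun n k => (-n.1) • c (n.1 - 1, n.2) k

/-- ∂ in the first variable pair of a two-variable distribution (z̄-component) -/
def d1zb (c : Dist2 K M) : Dist2 K M := fun n k => (-n.2) • c (n.1, n.2 - 1) k

/-- divided power d^{(x)} of an operator d, for a K-valued exponent x
(zero unless x ∈ ℕ) -/
def dPow {A : Type*} [AddCommGroup A] [Module K A] (d : A → A) (x : K) (a : A) : A :=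
  if h : ∃ j : ℕ, (j : K) = x then ((h.choose.factorial : K))⁻¹ • d^[h.choose] a else 0

/-- ∂_z^{(e_1)} ∂_z̄^{(e_2)} in the first variable pair -/
def ddPow2 (e : Idx K) (c : Dist2 K M) : Dist2 K M :=
  dPow K (d1z K M) e.1 (dPow K (d1zb K M) e.2 c)

/-- the diagonal map c(𝐳,𝐰) ↦ c(𝐰,𝐰) -/
def diag (c : Dist2 K M) : Dist1 K M :=
  fun n => ∑ᶠ m : Idx K, c m (n.1 - m.1 - 1, n.2 - m.2 - 1)

/-- multiplication by (𝐳−𝐰)^h (expansion in z>w), on coefficients;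
first index is 𝐳, second is 𝐰 -/
def zwPow (h : Idx K) (c : Dist2 K M) : Dist2 K M :=
  fun m k => ∑ᶠ i : ℕ × ℕ,
    ((-1 : K) ^ (i.1 + i.2) * gchoose K h.1 i.1 * gchoose K h.2 i.2) •
      c (m.1 + h.1 - i.1, m.2 + h.2 - i.2) (k.1 + i.1, k.2 + i.2)

/-- multiplication by ((𝐳−𝐰)_{w>z})^h = (−1)^h (𝐰−𝐳)^h (expansion in w>z) -/
def zwPowW (h : Idx K) (c : Dist2 K M) : Dist2 K M :=
  fun m k => ∑ᶠ i : ℕ × ℕ,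
    (negOnePow K (h.1 - h.2) * (-1 : K) ^ (i.1 + i.2) *
        gchoose K h.1 i.1 * gchoose K h.2 i.2) •
      c (m.1 + i.1, m.2 + i.2) (k.1 + h.1 - i.1, k.2 + h.2 - i.2)

/-- multiplication by (𝐱+𝐰)^N of a distribution d(𝐰,𝐱) (first index 𝐰, second 𝐱);
the result is indexed by (x-index, w-index) -/
def xwPow (N : Idx K) (d : Dist2 K M) : Dist2 K M :=
  fun m k => ∑ᶠ i : ℕ × ℕ, (gchoose K N.1 i.1 * gchoose K N.2 i.2) •
    d (k.1 + i.1, k.2 + i.2) (m.1 + N.1 - i.1, m.2 + N.2 - i.2)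

/-- multiplication by (𝐰+𝐱)^N of a distribution d(𝐰,𝐱) (first index 𝐰, second 𝐱);
the result is indexed by (x-index, w-index) -/
def wxPow (N : Idx K) (d : Dist2 K M) : Dist2 K M :=
  fun m k => ∑ᶠ i : ℕ × ℕ, (gchoose K N.1 i.1 * gchoose K N.2 i.2) •
    d (k.1 + N.1 - i.1, k.2 + N.2 - i.2) (m.1 + i.1, m.2 + i.2)

/-- multiplication by 𝐱^A 𝐰^B (𝐱+𝐰)^N of p(𝐰,𝐱); result indexed (x-index, w-index) -/
def tripleXW (A B N : Idx K) (p : Dist2 K M) : Dist2 K M :=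
  fun m k => ∑ᶠ l : ℕ × ℕ, (gchoose K N.1 l.1 * gchoose K N.2 l.2) •
    p (k.1 + B.1 + l.1, k.2 + B.2 + l.2) (m.1 + A.1 + N.1 - l.1, m.2 + A.2 + N.2 - l.2)

/-- multiplication by 𝐱^A 𝐰^B (𝐰+𝐱)^N of p(𝐰,𝐱); result indexed (x-index, w-index) -/
def tripleWX (A B N : Idx K) (p : Dist2 K M) : Dist2 K M :=
  fun m k => ∑ᶠ l : ℕ × ℕ, (gchoose K N.1 l.1 * gchoose K N.2 l.2) •
    p (k.1 + B.1 + N.1 - l.1, k.2 + B.2 + N.2 - l.2) (m.1 + A.1 + l.1, m.2 + A.2 + l.2)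

variable (E : Type*) [AddCommGroup E] [Module K E]

/-- End(E)-valued distributions in one variable pair -/
abbrev EDist1 := Dist1 K (Module.End K E)

/-- End(E)-valued distributions in two variable pairs -/
abbrev EDist2 := Dist2 K (Module.End K E)

/-- End(E)-valued distributions in r variable pairs -/
abbrev EDistN (r : ℕ) := DistN K (Module.End K E) r

def ev1 (a : EDist1 K E) (v : E) : Dist1 K E := fun n => a n v

def ev2 (c : EDist2 K E) (v : E) : Dist2 K E := fun n k => c n k v

def evN {r : ℕ} (c : EDistN K E r) (v : E) : DistN K E r := fun n => c n v

/-- a(𝐳) is a field -/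
def IsFieldD (a : EDist1 K E) : Prop := ∀ v, InLat1 K E (ev1 K E a v)

/-- a field in two variable pairs -/
def IsField2D (c : EDist2 K E) : Prop := ∀ v, InLat2 K E (ev2 K E c v)

/-- the Koszul sign (−1)^{pq} -/
def koszul (p q : ZMod 2) : K := if p = 1 ∧ q = 1 then (-1 : K) else 1

/-- the data (c^i, 𝐡_i) is an OPE of the homogeneous distributions a(𝐳), b(𝐳)
of parities pa, pb (all identities to be read applied to each vector of E) -/
def IsOPE (pa pb : ZMod 2) (a b : EDist1 K E) {r : ℕ}
    (c : Fin r → EDist2 K E) (h : Fin r → Idx K) : Prop :=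
  (∀ i, Kbar K (h i)) ∧ (∀ i, IsField2D K E (c i)) ∧
  (∀ v m k, a m (b k v) = ∑ i, zwPow K E (-(h i)) (ev2 K E (c i) v) m k) ∧
  (∀ v m k, koszul K pa pb • (b k (a m v)) =
      ∑ i, zwPowW K E (-(h i)) (ev2 K E (c i) v) m k)

/-- a(𝐳), b(𝐳) (homogeneous of parities pa, pb) are local -/
def IsLocal (pa pb : ZMod 2) (a b : EDist1 K E) : Prop :=
  ∃ (r : ℕ) (c : Fin r → EDist2 K E) (h : Fin r → Idx K), IsOPE K E pa pb a b c h

/-- the exponents of an OPE are reduced: 𝐡_i ∉ 𝐡_j + ℤ² for i ≠ j -/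
def ReducedExp {r : ℕ} (h : Fin r → Idx K) : Prop :=
  ∀ i j, i ≠ j → ¬ IsIntPair K (h i - h j)

/-- the product field a(𝐰)_{(𝐧)}b(𝐰) built from an OPE (c,h), applied to a vector v -/
def prodAt {r : ℕ} (c : Fin r → EDist2 K E) (h : Fin r → Idx K) (n : Idx K)
    (v : E) : Dist1 K E :=
  fun m => ∑ i, diag K E
    (ddPow2 K E ((h i).1 - 1 - n.1, (h i).2 - 1 - n.2) (ev2 K E (c i) v)) m

/-- s₁ : a(𝐳) ↦ a_{(−1,−1)}1 -/
def s1 (one : E) (a : EDist1 K E) : E := a ((-1 : K), (-1 : K)) one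

/-- the distribution d (to be thought of as a(𝐳)1) equals
Σ_{𝐢∈ℕ²} T^{(i)} T̄^{(ī)} (d_{(−1,−1)}) 𝐳^𝐢, i.e. a(𝐳) is creative -/
def CreativeD (T Tb : Module.End K E) (d : Dist1 K E) : Prop :=
  (∀ i : ℕ × ℕ, d (-(i.1 : K) - 1, -(i.2 : K) - 1) =
      ((i.1.factorial : K)⁻¹ * (i.2.factorial : K)⁻¹) •
        ((T ^ i.1) * (Tb ^ i.2)) (d ((-1 : K), (-1 : K)))) ∧
  (∀ n : Idx K, (¬ ∃ i : ℕ × ℕ, n = (-(i.1 : K) - 1, -(i.2 : K) - 1)) → d n = 0)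

/-- a(𝐳) is translation covariant for (T, T̄) -/
def TransCov (T Tb : Module.End K E) (a : EDist1 K E) : Prop :=
  (∀ n : Idx K, T * a n - a n * T = (-n.1) • a (n.1 - 1, n.2)) ∧
  (∀ n : Idx K, Tb * a n - a n * Tb = (-n.2) • a (n.1, n.2 - 1))

/-- translation covariance of a product field, per vector -/
def TransCovAt (T Tb : Module.End K E) (P : E → Dist1 K E) : Prop :=
  (∀ v (m : Idx K), T (P v m) - P (T v) m = (-m.1) • P v (m.1 - 1, m.2)) ∧
  (∀ v (m : Idx K), Tb (P v m) - P (Tb v) m = (-m.2) • P v (m.1, m.2 - 1))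

/-- the identity field 1(z) = id_E -/
def idField : EDist1 K E :=
  fun n => if n = ((-1 : K), (-1 : K)) then (1 : Module.End K E) else 0

/-- pairs i < j in [r] -/
abbrev Pairs (r : ℕ) := {p : Fin r × Fin r // p.1 < p.2}

/-- the index shift of the i-th variable produced by the monomial of a binomial
expansion of ((𝐳_{p₁} − 𝐳_{p₂})_σ)^h belonging to 𝐤 ∈ ℕ² -/
def pairShift {r : ℕ} (p : Pairs r) (h : Idx K) (flip : Bool) (kk : ℕ × ℕ)
    (i : Fin r) : Idx K :=
  if i = p.1.1 then
    (if flip then ((kk.1 : K), (kk.2 : K)) else (h.1 - kk.1, h.2 - kk.2))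
  else if i = p.1.2 then
    (if flip then (h.1 - kk.1, h.2 - kk.2) else ((kk.1 : K), (kk.2 : K)))
  else 0

/-- the coefficient of a binomial expansion of ((𝐳_{p₁} − 𝐳_{p₂})_σ)^h
belonging to 𝐤 ∈ ℕ² -/
def pairCoef (h : Idx K) (flip : Bool) (kk : ℕ × ℕ) : K :=
  (if flip then negOnePow K (h.1 - h.2) else 1) * (-1 : K) ^ (kk.1 + kk.2) *
    gchoose K h.1 kk.1 * gchoose K h.2 kk.2

def flipOf {r : ℕ} (σ : Equiv.Perm (Fin r)) (p : Pairs r) : Bool :=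
  decide (σ.symm p.1.2 < σ.symm p.1.1)

/-- multiplication by Π_{i<j} ((𝐳_i − 𝐳_j)_σ)^{h_{ij}} on an r-variable distribution -/
def permMul {r : ℕ} (σ : Equiv.Perm (Fin r)) (hs : Pairs r → Idx K)
    (c : DistN K M r) : DistN K M r :=
  fun m => ∑ᶠ κ : Pairs r → ℕ × ℕ,
    (∏ p : Pairs r, pairCoef K (hs p) (flipOf σ p) (κ p)) •
      c (fun i => m i + ∑ p : Pairs r, pairShift K p (hs p) (flipOf σ p) (κ p) i)

/-- the Koszul sign ζ' produced by reordering a¹,…,aʳ into a^{σ1},…,a^{σr} -/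
def koszulPerm {r : ℕ} (ps : Fin r → ZMod 2) (σ : Equiv.Perm (Fin r)) : K :=
  ∏ p : Pairs r,
    if σ.symm p.1.2 < σ.symm p.1.1 ∧ ps p.1.1 = 1 ∧ ps p.1.2 = 1 then (-1 : K) else 1

/-- the composition a^{σ1}(𝐳_{σ1})_{m_{σ1}} ∘ ⋯ ∘ a^{σr}(𝐳_{σr})_{m_{σr}} applied to v -/
def compSeq {r : ℕ} (a : Fin r → EDist1 K E) (σ : Equiv.Perm (Fin r))
    (m : Fin r → Idx K) (v : E) : E :=
  (List.ofFn fun j : Fin r => σ j).foldr (fun i acc => a i (m i) acc) v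

/-- the data (c^α, 𝐡_{ij}^k) is a (multiple) OPE of the homogeneous distributions
a¹(𝐳),…,aʳ(𝐳) of parities ps -/
def IsMultOPE {r : ℕ} (a : Fin r → EDist1 K E) (ps : Fin r → ZMod 2)
    (rij : Fin r → Fin r → ℕ) (hs : ∀ i j : Fin r, Fin (rij i j) → Idx K)
    (c : ((p : Pairs r) → Fin (rij p.1.1 p.1.2)) → EDistN K E r) : Prop :=
  (∀ i j k, Kbar K (hs i j k)) ∧
  (∀ α v, InLatN K E (evN K E (c α) v)) ∧
  (∀ σ : Equiv.Perm (Fin r), ∀ v m,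
    koszulPerm K ps σ • compSeq K E a σ m v =
      ∑ α : (p : Pairs r) → Fin (rij p.1.1 p.1.2),
        permMul K E σ (fun p => -(hs p.1.1 p.1.2 (α p))) (evN K E (c α) v) m)

/-- a¹(𝐳),…,aʳ(𝐳) are multiply local -/
def MultiplyLocal {r : ℕ} (a : Fin r → EDist1 K E) (ps : Fin r → ZMod 2) : Prop :=
  ∃ (rij : Fin r → Fin r → ℕ) (hs : ∀ i j : Fin r, Fin (rij i j) → Idx K)
    (c : ((p : Pairs r) → Fin (rij p.1.1 p.1.2)) → EDistN K E r),
      IsMultOPE K E a ps rij hs c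

/-- a set of homogeneous fields (with parities pF) is multiply local -/
def MultLocalSet (F : Set (EDist1 K E)) (pF : EDist1 K E → ZMod 2) : Prop :=
  ∀ (r : ℕ) (f : Fin r → EDist1 K E), (∀ i, f i ∈ F) →
    MultiplyLocal K E f (fun i => pF (f i))

/-- a set of homogeneous fields (with parities pF) is uniformly local -/
def UnifLocalSet (F : Set (EDist1 K E)) (pF : EDist1 K E → ZMod 2) (one : E) : Prop :=
  ∃ (rr : EDist1 K E → EDist1 K E → ℕ)
    (hh : ∀ d e : EDist1 K E, Fin (rr d e) → Idx K),
    ∀ (r : ℕ) (f : Fin r → EDist1 K E), (∀ i, f i ∈ F) →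
      ∃ c, IsMultOPE K E f (fun i => pF (f i)) (fun i j => rr (f i) (f j))
          (fun i j => hh (f i) (f j)) c ∧
        ∀ α, IsPowN K E (evN K E (c α) one)

/-- a ∈ V is homogeneous of parity p w.r.t. the grading (ev, od) -/
def memPar {V : Type*} [AddCommGroup V] [Module K V] (ev od : Submodule K V)
    (a : V) (p : ZMod 2) : Prop :=
  (p = 0 ∧ a ∈ ev) ∨ (p = 1 ∧ a ∈ od)

/-- an endomorphism is homogeneous of parity p w.r.t. the grading (ev, od) -/
def EndPar {V : Type*} [AddCommGroup V] [Module K V] (ev od : Submodule K V)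
    (f : Module.End K V) (p : ZMod 2) : Prop :=
  if p = 0 then (∀ v ∈ ev, f v ∈ ev) ∧ (∀ v ∈ od, f v ∈ od)
  else (∀ v ∈ ev, f v ∈ od) ∧ (∀ v ∈ od, f v ∈ ev)

/-- a distribution is homogeneous of parity p -/
def EDistPar {V : Type*} [AddCommGroup V] [Module K V] (ev od : Submodule K V)
    (a : EDist1 K V) (p : ZMod 2) : Prop :=
  ∀ n, EndPar K ev od (a n) p

end OPEA

namespace OPEA

/-- an OPE-algebra -/
structure OPEAlg (K : Type*) [Field K] [CharZero K]
    (V : Type*) [AddCommGroup V] [Module K V] where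
  ev : Submodule K V
  od : Submodule K V
  compl : IsCompl ev od
  Y : V →ₗ[K] EDist1 K V
  Y_par : ∀ a p, memPar K ev od a p → ∀ (n : Idx K) b q, memPar K ev od b q →
    memPar K ev od (Y a n b) (p + q)
  one : V
  one_ev : one ∈ ev
  T : Module.End K V
  Tb : Module.End K V
  T_ev : EndPar K ev od T 0
  Tb_ev : EndPar K ev od Tb 0
  commTTb : T * Tb = Tb * T
  T_one : T one = 0
  Tb_one : Tb one = 0
  wcre : ∀ a, IsPow1 K V (ev1 K V (Y a) one)
  rid : ∀ a, Y a ((-1 : K), (-1 : K)) one = a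
  tcov : ∀ a, TransCov K V T Tb (Y a)
  loc : ∀ a b pa pb, memPar K ev od a pa → memPar K ev od b pb →
    IsLocal K V pa pb (Y a) (Y b)

/-- a bounded 𝕂̄-fold algebra -/
structure BFold (K : Type*) [Field K] [CharZero K]
    (V : Type*) [AddCommGroup V] [Module K V] where
  ev : Submodule K V
  od : Submodule K V
  compl : IsCompl ev od
  Y : V →ₗ[K] EDist1 K V
  Y_par : ∀ a p, memPar K ev od a p → ∀ (n : Idx K) b q, memPar K ev od b q →
    memPar K ev od (Y a n b) (p + q)
  fields : ∀ a, IsFieldD K V (Y a)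
  bounded : ∀ a (n : Idx K), ¬ Kbar K n → ∀ b, Y a n b = 0

/-- a bounded 𝕂̄-fold module over a bounded 𝕂̄-fold algebra -/
structure BMod (K : Type*) [Field K] [CharZero K]
    (V : Type*) [AddCommGroup V] [Module K V] (A : BFold K V)
    (Mo : Type*) [AddCommGroup Mo] [Module K Mo] where
  evM : Submodule K Mo
  odM : Submodule K Mo
  complM : IsCompl evM odM
  YM : V →ₗ[K] EDist1 K Mo
  YM_par : ∀ a p, memPar K A.ev A.od a p → ∀ n : Idx K, EndPar K evM odM (YM a n) p
  fieldsM : ∀ a, IsFieldD K Mo (YM a)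
  boundedM : ∀ a (n : Idx K), ¬ Kbar K n → ∀ c, YM a n c = 0

variable (K : Type*) [Field K] [CharZero K]
variable (V : Type*) [AddCommGroup V] [Module K V]
variable (Mo : Type*) [AddCommGroup Mo] [Module K Mo]

/-- the operator T₁ : a ↦ a_{(−2,−1)}1 of an OPE-algebra -/
def T1 (A : OPEAlg K V) : Module.End K V where
  toFun := fun a => A.Y a ((-2 : K), (-1 : K)) A.one
  map_add' := by
    intro x y
    simp [map_add, Pi.add_apply, LinearMap.add_apply]
  map_smul' := by
    intro c x
    simp [map_smul, Pi.smul_apply, LinearMap.smul_apply]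

/-- the operator T̄₁ : a ↦ a_{(−1,−2)}1 of an OPE-algebra -/
def T1b (A : OPEAlg K V) : Module.End K V where
  toFun := fun a => A.Y a ((-1 : K), (-2 : K)) A.one
  map_add' := by
    intro x y
    simp [map_add, Pi.add_apply, LinearMap.add_apply]
  map_smul' := by
    intro c x
    simp [map_smul, Pi.smul_apply, LinearMap.smul_apply]

/-- skew-symmetry for the pair (T, T̄) -/
def SkewSym (ev od : Submodule K V) (Yf : V → EDist1 K V)
    (T Tb : Module.End K V) : Prop :=
  ∀ a b pa pb, memPar K ev od a pa → memPar K ev od b pb →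
    ∀ n : Idx K, Kbar K n →
      (Function.support (fun i : ℕ × ℕ =>
        ((i.1.factorial : K)⁻¹ * (i.2.factorial : K)⁻¹ *
            negOnePow K (n.1 + i.1 - (n.2 + i.2))) •
          ((T ^ i.1) * (Tb ^ i.2)) (Yf a (n.1 + i.1, n.2 + i.2) b))).Finite ∧
      koszul K pa pb • Yf b n a =
        ∑ᶠ i : ℕ × ℕ, ((i.1.factorial : K)⁻¹ * (i.2.factorial : K)⁻¹ *
            negOnePow K (n.1 + i.1 - (n.2 + i.2))) •
          ((T ^ i.1) * (Tb ^ i.2)) (Yf a (n.1 + i.1, n.2 + i.2) b)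

/-- (T, T̄) is a translation endomorphism of the module with state-field map YM -/
def TransEnd (YM : V → EDist1 K Mo) (T Tb : Module.End K V) : Prop :=
  (∀ a (n : Idx K), YM (T a) n = (-n.1) • YM a (n.1 - 1, n.2)) ∧
  (∀ a (n : Idx K), YM (Tb a) n = (-n.2) • YM a (n.1, n.2 - 1))

/-- the coefficient at (x-index m, w-index k) of a(𝐱+𝐰) applied to the w-distribution bw -/
def lhsXW (YM : V → EDist1 K Mo) (a : V) (bw : Dist1 K Mo) (m k : Idx K) : Mo :=
  ∑ᶠ i : ℕ × ℕ, ((i.1.factorial : K)⁻¹ * (i.2.factorial : K)⁻¹) •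
    (((dz K (Module.End K Mo))^[i.1] ((dzb K (Module.End K Mo))^[i.2] (YM a))) m)
      (bw (k.1 + i.1, k.2 + i.2))

/-- a and cM are dual in the direct channel -/
def DualDirect (Y : V → EDist1 K V) (YM : V → EDist1 K Mo) (a : V) (cM : Mo) : Prop :=
  ∃ (s : ℕ) (d : Fin s → Idx K → Idx K → (V →ₗ[K] Mo)) (hj : Fin s → Idx K),
    (∀ j, Kbar K (hj j)) ∧
    (∀ j b, InLat2 K Mo (fun kw mx => d j kw mx b)) ∧
    (∀ b (m k : Idx K),
      lhsXW K V Mo YM a (fun k' => YM b k' cM) m k =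
        ∑ j, xwPow K Mo (-(hj j)) (fun kw mx => d j kw mx b) m k) ∧
    (∀ b (m k : Idx K),
      YM (Y a m b) k cM =
        ∑ j, wxPow K Mo (-(hj j)) (fun kw mx => d j kw mx b) m k)

/-- a and b are dual in the exchange channel on the module -/
def DualExch (Y : V → EDist1 K V) (YM : V → EDist1 K Mo) (a b : V) : Prop :=
  ∃ (r : ℕ) (hab : Fin r → Idx K), (∀ i, Kbar K (hab i)) ∧
    ∀ cM : Mo, ∃ (s : ℕ) (hac : Fin s → Idx K)
      (q : Fin r → Fin s → Idx K → Idx K → Mo),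
      (∀ j, Kbar K (hac j)) ∧
      (∀ i j kw mx, q i j kw mx ≠ 0 → IsNegInt K mx.1 ∧ IsNegInt K mx.2) ∧
      (∀ i j mx, InLat1 K Mo (fun kw => q i j kw mx)) ∧
      (∀ m k : Idx K,
        lhsXW K V Mo YM a (fun k' => YM b k' cM) m k =
          ∑ j, xwPow K Mo (-(hac j))
            (fun kw mx => ∑ i, q i j kw (mx.1 - (hab i).1, mx.2 - (hab i).2)) m k) ∧
      (∀ m k : Idx K,
        YM (Y a m b) k cM =
          ∑ j, wxPow K Mo (-(hac j))
            (fun kw mx => ∑ i, q i j kw (mx.1 - (hab i).1, mx.2 - (hab i).2)) m k)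

/-- the module with state-field map YM is dual -/
def IsDualMod (ev od : Submodule K V) (Y : V → EDist1 K V) (YM : V → EDist1 K Mo) : Prop :=
  ∃ (rVV : V → V → ℕ) (hVV : ∀ a b : V, Fin (rVV a b) → Idx K)
    (rVM : V → Mo → ℕ) (hVM : ∀ (a : V) (c : Mo), Fin (rVM a c) → Idx K),
    (∀ a b i, Kbar K (hVV a b i)) ∧ (∀ a c j, Kbar K (hVM a c j)) ∧
    ∀ a b pa pb, memPar K ev od a pa → memPar K ev od b pb → ∀ c : Mo,
      ∃ p : Fin (rVV a b) → Fin (rVM a c) → Fin (rVM b c) → Dist2 K Mo,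
        (∀ i j k, IsPow2 K Mo (p i j k)) ∧
        (∀ m k : Idx K,
          lhsXW K V Mo YM a (fun k' => YM b k' c) m k =
            ∑ i, ∑ j, ∑ kk, tripleXW K Mo (-(hVV a b i)) (-(hVM b c kk))
              (-(hVM a c j)) (p i j kk) m k) ∧
        (∀ m k : Idx K,
          YM (Y a m b) k c =
            ∑ i, ∑ j, ∑ kk, tripleWX K Mo (-(hVV a b i)) (-(hVM b c kk))
              (-(hVM a c j)) (p i j kk) m k)

/-- F_Y is multiply local -/
def MultLocalAlg (A : OPEAlg K V) : Prop :=
  ∀ (r : ℕ) (f : Fin r → V) (pf : Fin r → ZMod 2),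
    (∀ i, memPar K A.ev A.od (f i) (pf i)) →
      MultiplyLocal K V (fun i => A.Y (f i)) pf

/-- F_Y is uniformly local -/
def UnifLocalAlg (A : OPEAlg K V) : Prop :=
  ∃ (rr : V → V → ℕ) (hh : ∀ a b : V, Fin (rr a b) → Idx K),
    ∀ (r : ℕ) (f : Fin r → V) (pf : Fin r → ZMod 2),
      (∀ i, memPar K A.ev A.od (f i) (pf i)) →
        ∃ c, IsMultOPE K V (fun i => A.Y (f i)) pf (fun i j => rr (f i) (f j))
            (fun i j => hh (f i) (f j)) c ∧
          ∀ α, IsPowN K V (evN K V (c α) A.one)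

end OPEA
namespace OPEA

set_option linter.unusedSectionVars false

section Scalars

variable {K : Type*} [Field K] [CharZero K]

lemma gchoose_eq_choose (x : K) (j : ℕ) : gchoose K x j = Ring.choose x j := by
  rw [Ring.choose_eq_smul, gchoose, div_eq_inv_mul, smul_eq_mul,
    ← Polynomial.aeval_eq_smeval, Polynomial.aeval_def, Polynomial.eval₂_eq_eval_map,
    descPochhammer_map, descPochhammer_eval_eq_prod_range]

lemma gchoose_zero (x : K) : gchoose K x 0 = 1 := by simp [gchoose]

lemma gchoose_succ (x : K) (j : ℕ) :
    ((j : K) + 1) * gchoose K x (j + 1) = (x - j) * gchoose K x j := by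
  have h : (j.factorial : K) ≠ 0 := by exact_mod_cast j.factorial_ne_zero
  have h' : (j : K) + 1 ≠ 0 := by exact_mod_cast j.succ_ne_zero
  rw [gchoose, gchoose, Finset.prod_range_succ, Nat.factorial_succ]
  push_cast
  field_simp

lemma gchoose_pascal (x : K) (j : ℕ) :
    gchoose K (x + 1) (j + 1) = gchoose K x (j + 1) + gchoose K x j := by
  simp only [gchoose_eq_choose]
  rw [Ring.choose_succ_succ, add_comm]

lemma gchoose_add (a b : K) (N : ℕ) :
    gchoose K (a + b) N = ∑ i ∈ Finset.range (N + 1), gchoose K a i * gchoose K b (N - i) := by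
  simp only [gchoose_eq_choose]
  rw [Ring.add_choose_eq N (Commute.all a b),
    Finset.Nat.sum_antidiagonal_eq_sum_range_succ (fun i j => Ring.choose a i * Ring.choose b j)]

lemma gchoose_mul_gchoose_natCast (a : K) {i j : ℕ} (h : j ≤ i) :
    gchoose K (i : K) j * gchoose K a i = gchoose K a j * gchoose K (a - j) (i - j) := by
  simp only [gchoose_eq_choose]
  rw [Ring.choose_natCast, ← Ring.choose_smul_choose a h, nsmul_eq_mul]

lemma gchoose_natCast_of_lt {i j : ℕ} (h : i < j) : gchoose K (i : K) j = 0 := by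
  rw [gchoose_eq_choose, Ring.choose_natCast, Nat.choose_eq_zero_of_lt h, Nat.cast_zero]

lemma gchoose_mul_gchoose_sub (a : K) (i j : ℕ) :
    gchoose K a i * gchoose K (a - i) j = gchoose K a j * gchoose K (a - j) i := by
  simp only [gchoose_eq_choose]
  have h1 := Ring.choose_smul_choose a (Nat.le_add_right i j)
  have h2 := Ring.choose_smul_choose a (Nat.le_add_left j i)
  rw [Nat.add_sub_cancel_left] at h1
  rw [Nat.add_sub_cancel] at h2
  rw [← h1, ← h2, Nat.choose_symm_add]

lemma neg_one_pow_mul_gchoose (x : K) (j : ℕ) :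
    (-1) ^ j * gchoose K (j - 1 - x) j = gchoose K x j := by
  have : ∀ x : K, gchoose K x j = (∏ i ∈ Finset.range j, (x - (i : K))) / (j.factorial : K) :=
    fun _ => rfl
  rw [this, this, ← mul_div_assoc]
  congr 1
  rw [← Finset.prod_range_reflect (fun i : ℕ => (j - 1 - x - (i : K)))]
  rw [← Finset.card_range j, ← Finset.prod_const, Finset.card_range, ← Finset.prod_mul_distrib]
  refine Finset.prod_congr rfl fun i hi => ?_
  have : i + 1 ≤ j := Finset.mem_range.1 hi
  rw [Nat.sub_sub, Nat.cast_sub (by omega)]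
  push_cast
  ring

/-- extension by zero of a function on `ℕ` to a function on `K` -/
def natExt (f : ℕ → K) (x : K) : K := if h : ∃ j : ℕ, (j : K) = x then f h.choose else 0

lemma natExt_natCast (f : ℕ → K) (j : ℕ) : natExt f (j : K) = f j := by
  have h : ∃ i : ℕ, (i : K) = j := ⟨j, rfl⟩
  rw [natExt, dif_pos h, Nat.cast_injective h.choose_spec]

lemma natExt_of_not {f : ℕ → K} {x : K} (h : ¬ ∃ j : ℕ, (j : K) = x) : natExt f x = 0 :=
  dif_neg h

lemma exists_of_natExt_ne {f : ℕ → K} {x : K} (h : natExt f x ≠ 0) : ∃ j : ℕ, (j : K) = x :=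
  by_contra fun h' => h (natExt_of_not h')

/-- the binomial coefficient `C(x, e)`, zero unless `e ∈ ℕ` -/
def bin (x e : K) : K := natExt (gchoose K x) e

/-- the coefficient of `q ^ x` in `(1 - q) ^ a` -/
def kap (a x : K) : K := natExt (fun j => (-1) ^ j * gchoose K a j) x

lemma bin_natCast (x : K) (j : ℕ) : bin x (j : K) = gchoose K x j := natExt_natCast _ j

lemma kap_natCast (a : K) (j : ℕ) : kap a (j : K) = (-1) ^ j * gchoose K a j := natExt_natCast _ j

lemma neg_one_not_nat : ¬ ∃ j : ℕ, (j : K) = 0 - 1 := by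
  rintro ⟨j, hj⟩
  have : ((j + 1 : ℕ) : K) = 0 := by push_cast; rw [hj]; ring
  exact absurd (Nat.cast_eq_zero.1 this) (Nat.succ_ne_zero j)

lemma natExt_pascal {f g g' : ℕ → K} (h0 : f 0 = g 0) (h : ∀ j, f (j + 1) = g (j + 1) + g' j)
    (x : K) : natExt f x = natExt g x + natExt g' (x - 1) := by
  by_cases hx : ∃ j : ℕ, (j : K) = x
  · obtain ⟨j, rfl⟩ := hx
    cases j with
    | zero =>
      rw [natExt_natCast, natExt_natCast, h0, Nat.cast_zero, natExt_of_not neg_one_not_nat,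
        add_zero]
    | succ j =>
      have : ((j + 1 : ℕ) : K) - 1 = j := by push_cast; ring
      rw [this, natExt_natCast, natExt_natCast, natExt_natCast, h]
  · have hx' : ¬ ∃ j : ℕ, (j : K) = x - 1 := by
      rintro ⟨j, hj⟩
      exact hx ⟨j + 1, by push_cast; rw [hj]; ring⟩
    rw [natExt_of_not hx, natExt_of_not hx, natExt_of_not hx', add_zero]

lemma bin_pascal (x e : K) : bin (x + 1) e = bin x e + bin x (e - 1) :=
  natExt_pascal (by simp [gchoose_zero]) (fun j => gchoose_pascal x j) e

lemma kap_pascal (a x : K) : kap a x = kap (a + 1) x + kap a (x - 1) :=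
  natExt_pascal (by simp [gchoose_zero]) (fun j => by rw [gchoose_pascal, pow_succ]; ring) x

lemma bin_zero_left (e : K) : bin 0 e = if e = 0 then 1 else 0 := by
  by_cases he : ∃ j : ℕ, (j : K) = e
  · obtain ⟨j, rfl⟩ := he
    rw [bin_natCast, gchoose_eq_choose, Ring.choose_zero_ite]
    simp
  · have : e ≠ 0 := fun h => he ⟨0, by simp [h]⟩
    rw [bin, natExt_of_not he, if_neg this]

lemma kap_zero_left (x : K) : kap 0 x = if x = 0 then 1 else 0 := by
  by_cases he : ∃ j : ℕ, (j : K) = x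
  · obtain ⟨j, rfl⟩ := he
    rw [kap_natCast, gchoose_eq_choose, Ring.choose_zero_ite]
    by_cases hj : j = 0 <;> simp [hj]
  · have : x ≠ 0 := fun h => he ⟨0, by simp [h]⟩
    rw [kap, natExt_of_not he, if_neg this]

/-- the natural numbers `i ≤ x`, if `x ∈ ℕ`, and the empty set otherwise -/
def natBelow (x : K) : Finset ℕ :=
  if h : ∃ j : ℕ, (j : K) = x then Finset.range (h.choose + 1) else ∅

lemma natBelow_natCast (j : ℕ) : natBelow (j : K) = Finset.range (j + 1) := by
  have h : ∃ i : ℕ, (i : K) = j := ⟨j, rfl⟩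
  rw [natBelow, dif_pos h, Nat.cast_injective h.choose_spec]

lemma natBelow_of_not {x : K} (h : ¬ ∃ j : ℕ, (j : K) = x) : natBelow x = ∅ := dif_neg h

lemma mem_natBelow {x : K} {i : ℕ} : i ∈ natBelow x ↔ ∃ j : ℕ, (i : K) + j = x := by
  by_cases h : ∃ j : ℕ, (j : K) = x
  · obtain ⟨j, rfl⟩ := h
    rw [natBelow_natCast, Finset.mem_range]
    constructor
    · intro h
      exact ⟨j - i, by rw [Nat.cast_sub (by omega)]; ring⟩
    · rintro ⟨k, hk⟩
      have : i + k = j := by exact_mod_cast hk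
      omega
  · rw [natBelow_of_not h]
    simp only [Finset.notMem_empty, false_iff]
    rintro ⟨j, hj⟩
    exact h ⟨i + j, by push_cast; exact hj⟩

lemma kap_conv (a b : K) (N : ℕ) :
    ∑ i ∈ Finset.range (N + 1), kap a (i : K) * kap b ((N : K) - i) = kap (a + b) (N : K) := by
  rw [kap_natCast, gchoose_add, Finset.mul_sum]
  refine Finset.sum_congr rfl fun i hi => ?_
  have : i ≤ N := by have := Finset.mem_range.1 hi; omega
  rw [← Nat.cast_sub this, kap_natCast, kap_natCast]
  have h2 : (-1 : K) ^ N = (-1) ^ i * (-1) ^ (N - i) := by rw [← pow_add]; congr 1; omega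
  rw [h2]
  ring

lemma kap_conv_shift (a b : K) (N j : ℕ) :
    ∑ i ∈ Finset.range (N + 1), kap a ((i : K) - j) * kap b ((N : K) - i) =
      kap (a + b) ((N : K) - j) := by
  by_cases hj : j ≤ N
  · obtain ⟨M, rfl⟩ := Nat.exists_eq_add_of_le hj
    have e1 : ((j + M : ℕ) : K) - j = (M : ℕ) := by push_cast; ring
    rw [e1, ← kap_conv, add_assoc, Finset.sum_range_add]
    rw [Finset.sum_eq_zero, zero_add]
    · refine Finset.sum_congr rfl fun i _ => ?_
      congr 2 <;> push_cast <;> ring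
    · intro i hi
      have hi' := Finset.mem_range.1 hi
      have : ¬ ∃ l : ℕ, (l : K) = (i : K) - j := by
        rintro ⟨l, hl⟩
        have : l + j = i := by
          have : ((l + j : ℕ) : K) = (i : ℕ) := by push_cast; rw [hl]; ring
          exact_mod_cast this
        omega
      rw [kap, natExt_of_not this, zero_mul]
  · have : ∀ i ≤ N, ¬ ∃ l : ℕ, (l : K) = (i : K) - j := by
      rintro i hi ⟨l, hl⟩
      have : l + j = i := by
        have : ((l + j : ℕ) : K) = (i : ℕ) := by push_cast; rw [hl]; ring
        exact_mod_cast this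
      omega
    conv_rhs => rw [kap, natExt_of_not (this N le_rfl)]
    refine Finset.sum_eq_zero fun i hi => ?_
    rw [kap, natExt_of_not (this i (by have := Finset.mem_range.1 hi; omega)), zero_mul]

lemma bin_add (a b e : K) :
    bin (a + b) e = ∑ j ∈ natBelow e, gchoose K b j * bin a (e - j) := by
  by_cases he : ∃ j : ℕ, (j : K) = e
  · obtain ⟨n, rfl⟩ := he
    rw [bin_natCast, natBelow_natCast, add_comm, gchoose_add]
    refine Finset.sum_congr rfl fun i hi => ?_
    have : i ≤ n := by have := Finset.mem_range.1 hi; omega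
    rw [← Nat.cast_sub this, bin_natCast]
  · rw [natBelow_of_not he, Finset.sum_empty, bin, natExt_of_not he]

/-- the coefficient form of the Leibniz rule for `∂ ^ (e)` applied to `z ^ A * (z - u) ^ a`,
expanded in `z > u` and multiplied by `(w - u) ^ b` -/
lemma leibniz_left (A a b e x : K) :
    ∑ i ∈ natBelow x, bin (A + (a - i)) e * (kap a (i : K) * kap b (x - i)) =
      ∑ j ∈ natBelow e, gchoose K a j * bin A (e - j) * kap (a + b - j) x := by
  by_cases hx : ∃ j : ℕ, (j : K) = x
  · obtain ⟨N, rfl⟩ := hx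
    rw [natBelow_natCast]
    simp only [bin_add A, Finset.sum_mul]
    rw [Finset.sum_comm]
    refine Finset.sum_congr rfl fun j _ => ?_
    have : a + b - j = (a - j) + b := by ring
    rw [this, ← kap_conv, Finset.mul_sum]
    refine Finset.sum_congr rfl fun i _ => ?_
    rw [kap_natCast, kap_natCast]
    linear_combination bin A (e - j) * (-1) ^ i * kap b (N - i) * gchoose_mul_gchoose_sub a i j
  · rw [natBelow_of_not hx, Finset.sum_empty]
    symm
    refine Finset.sum_eq_zero fun j _ => ?_
    rw [kap, natExt_of_not hx, mul_zero]

/-- the coefficient form of the Leibniz rule for `∂ ^ (e)` applied to `z ^ A * (u - z) ^ a`,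
expanded in `u > z` and multiplied by `(u - w) ^ b` -/
lemma leibniz_right (A a b e x : K) :
    ∑ i ∈ natBelow x, bin (A + i) e * (kap a (i : K) * kap b (x - i)) =
      ∑ j ∈ natBelow e, (-1) ^ j * (gchoose K a j * bin A (e - j)) * kap (a + b - j) (x - j) := by
  by_cases hx : ∃ j : ℕ, (j : K) = x
  · obtain ⟨N, rfl⟩ := hx
    rw [natBelow_natCast]
    simp only [bin_add A, Finset.sum_mul]
    rw [Finset.sum_comm]
    refine Finset.sum_congr rfl fun j _ => ?_
    have : a + b - j = (a - j) + b := by ring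
    rw [this, ← kap_conv_shift, Finset.mul_sum]
    refine Finset.sum_congr rfl fun i _ => ?_
    have key : gchoose K (i : K) j * kap a (i : K) =
        (-1) ^ j * gchoose K a j * kap (a - j) ((i : K) - j) := by
      rw [kap_natCast]
      rcases lt_or_ge i j with hij | hij
      · have : ¬ ∃ l : ℕ, (l : K) = (i : K) - j := by
          rintro ⟨l, hl⟩
          have : l + j = i := by
            have : ((l + j : ℕ) : K) = (i : ℕ) := by push_cast; rw [hl]; ring
            exact_mod_cast this
          omega
        rw [gchoose_natCast_of_lt hij, kap, natExt_of_not this, zero_mul, mul_zero]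
      · rw [← Nat.cast_sub hij, kap_natCast]
        have h2 : (-1 : K) ^ i = (-1) ^ j * (-1) ^ (i - j) := by
          rw [← pow_add]; congr 1; omega
        rw [h2]
        linear_combination (-1) ^ j * (-1) ^ (i - j) * gchoose_mul_gchoose_natCast a hij
    linear_combination bin A (e - j) * kap b (N - i) * key
  · have hx' : ∀ j : ℕ, ¬ ∃ i : ℕ, (i : K) = x - j := by
      rintro j ⟨i, hi⟩
      exact hx ⟨i + j, by push_cast; rw [hi]; ring⟩
    rw [natBelow_of_not hx, Finset.sum_empty]
    symm
    refine Finset.sum_eq_zero fun j _ => ?_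
    rw [kap, natExt_of_not (hx' j), mul_zero]

/-- `kap (-x - 1) l` is the coefficient `C(x + l, l)` -/
lemma kap_neg_sub_one (x : K) (l : ℕ) : kap (-(x - l) - 1) (l : K) = gchoose K x l := by
  rw [kap_natCast, ← neg_one_pow_mul_gchoose x]
  congr 2
  ring

lemma negOnePow_intCast (k : ℤ) : negOnePow K (k : K) = (-1) ^ k := by
  have h : ∃ i : ℤ, (i : K) = k := ⟨k, rfl⟩
  rw [negOnePow, dif_pos h, Int.cast_injective h.choose_spec]

end Scalars

section Functionals

variable {K : Type*} [Field K] [CharZero K]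

/-- the embedding of `ℕ × ℕ` into the index pairs -/
def emb (K : Type*) [Field K] (i : ℕ × ℕ) : Idx K := ((i.1 : K), (i.2 : K))

lemma emb_injective : Function.Injective (emb K) := by
  rintro ⟨a, b⟩ ⟨c, d⟩ h
  simpa [emb] using h

lemma emb_add (i j : ℕ × ℕ) : emb K (i + j) = emb K i + emb K j := by
  simp [emb]

lemma emb_zero : emb K 0 = 0 := by simp [emb]

/-- the coefficient of `q ^ x` in `(1 - q) ^ a`, for index pairs `a` and `x` -/
def kap2 (a x : Idx K) : K := kap a.1 x.1 * kap a.2 x.2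

/-- the binomial coefficient `C(x, e)` for index pairs, zero unless `e ∈ ℕ²` -/
def bin2 (x e : Idx K) : K := bin x.1 e.1 * bin x.2 e.2

lemma kap2_emb (a : Idx K) (i : ℕ × ℕ) :
    kap2 a (emb K i) = (-1) ^ (i.1 + i.2) * gchoose K a.1 i.1 * gchoose K a.2 i.2 := by
  rw [kap2, emb, kap_natCast, kap_natCast, pow_add]
  ring

lemma exists_emb_iff {x : Idx K} :
    (∃ i, emb K i = x) ↔ (∃ i : ℕ, (i : K) = x.1) ∧ ∃ i : ℕ, (i : K) = x.2 := by
  constructor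
  · rintro ⟨i, rfl⟩
    exact ⟨⟨i.1, rfl⟩, ⟨i.2, rfl⟩⟩
  · rintro ⟨⟨i, hi⟩, ⟨j, hj⟩⟩
    exact ⟨(i, j), Prod.ext hi hj⟩

lemma exists_of_kap2_ne {a x : Idx K} (h : kap2 a x ≠ 0) : ∃ i, emb K i = x :=
  exists_emb_iff.2 ⟨exists_of_natExt_ne (left_ne_zero_of_mul h),
    exists_of_natExt_ne (right_ne_zero_of_mul h)⟩

lemma kap2_zero_left (x : Idx K) : kap2 0 x = if x = 0 then 1 else 0 := by
  rw [kap2, Prod.fst_zero, Prod.snd_zero, kap_zero_left, kap_zero_left]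
  by_cases h1 : x.1 = 0 <;> by_cases h2 : x.2 = 0 <;> simp [h1, h2, Prod.ext_iff]

lemma bin2_zero_left (x : Idx K) : bin2 0 x = if x = 0 then 1 else 0 := by
  rw [bin2, Prod.fst_zero, Prod.snd_zero, bin_zero_left, bin_zero_left]
  by_cases h1 : x.1 = 0 <;> by_cases h2 : x.2 = 0 <;> simp [h1, h2, Prod.ext_iff]

/-- the pairs `i ≤ x` in `ℕ × ℕ`, if `x ∈ ℕ²`, and the empty set otherwise -/
def pairBelow (x : Idx K) : Finset (ℕ × ℕ) := natBelow x.1 ×ˢ natBelow x.2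

lemma mem_pairBelow {x : Idx K} {i : ℕ × ℕ} :
    i ∈ pairBelow x ↔ ∃ j, emb K i + emb K j = x := by
  rw [pairBelow, Finset.mem_product, mem_natBelow, mem_natBelow]
  constructor
  · rintro ⟨⟨a, ha⟩, ⟨b, hb⟩⟩
    exact ⟨(a, b), Prod.ext ha hb⟩
  · rintro ⟨j, rfl⟩
    exact ⟨⟨j.1, rfl⟩, ⟨j.2, rfl⟩⟩

lemma leibniz_left_pair (A a b e x : Idx K) :
    ∑ i ∈ pairBelow x, bin2 (A + (a - emb K i)) e * (kap2 a (emb K i) * kap2 b (x - emb K i)) =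
      ∑ j ∈ pairBelow e, gchoose K a.1 j.1 * gchoose K a.2 j.2 * bin2 A (e - emb K j) *
        kap2 (a + b - emb K j) x := by
  have h := congrArg₂ (fun u v : K => u * v) (leibniz_left A.1 a.1 b.1 e.1 x.1)
    (leibniz_left A.2 a.2 b.2 e.2 x.2)
  simp only [Finset.sum_mul_sum, ← Finset.sum_product'] at h
  refine Eq.trans (Finset.sum_congr rfl fun i _ => ?_)
    (h.trans (Finset.sum_congr rfl fun i _ => ?_))
  · simp only [bin2, kap2, emb, Prod.fst_add, Prod.snd_add, Prod.fst_sub, Prod.snd_sub]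
    ring
  · simp only [bin2, kap2, emb, Prod.fst_add, Prod.snd_add, Prod.fst_sub, Prod.snd_sub]
    ring

lemma leibniz_right_pair (A a b e x : Idx K) :
    ∑ i ∈ pairBelow x, bin2 (A + emb K i) e * (kap2 a (emb K i) * kap2 b (x - emb K i)) =
      ∑ j ∈ pairBelow e, (-1) ^ (j.1 + j.2) *
        (gchoose K a.1 j.1 * gchoose K a.2 j.2 * bin2 A (e - emb K j)) *
          kap2 (a + b - emb K j) (x - emb K j) := by
  have h := congrArg₂ (fun u v : K => u * v) (leibniz_right A.1 a.1 b.1 e.1 x.1)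
    (leibniz_right A.2 a.2 b.2 e.2 x.2)
  simp only [Finset.sum_mul_sum, ← Finset.sum_product'] at h
  refine Eq.trans (Finset.sum_congr rfl fun i _ => ?_)
    (h.trans (Finset.sum_congr rfl fun i _ => ?_))
  · simp only [bin2, kap2, emb, Prod.fst_add, Prod.snd_add, Prod.fst_sub, Prod.snd_sub]
    ring
  · simp only [bin2, kap2, emb, Prod.fst_add, Prod.snd_add, Prod.fst_sub, Prod.snd_sub, pow_add]
    ring

/-- the sign `(-1) ^ 𝐡` -/
def sgn (h : Idx K) : K := negOnePow K (h.1 - h.2)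

lemma sgn_eq {h : Idx K} (hh : Kbar K h) (i j : ℤ) :
    sgn (h + ((i : K), (j : K))) = (-1) ^ (i - j) * sgn h := by
  obtain ⟨k, hk⟩ := hh
  have e : (h + ((i : K), (j : K))).1 - (h + ((i : K), (j : K))).2 = ((i - j + k : ℤ) : K) := by
    simp only [Prod.fst_add, Prod.snd_add]
    push_cast
    rw [hk]
    ring
  rw [sgn, sgn, e, ← hk, negOnePow_intCast, negOnePow_intCast, zpow_add₀ (by simp)]

lemma sgn_add {h h' : Idx K} (hh : Kbar K h) (hh' : Kbar K h') :
    sgn (h + h') = sgn h * sgn h' := by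
  obtain ⟨k, hk⟩ := hh
  obtain ⟨k', hk'⟩ := hh'
  have e : (h + h').1 - (h + h').2 = ((k + k' : ℤ) : K) := by
    simp only [Prod.fst_add, Prod.snd_add]
    push_cast
    rw [hk, hk']
    ring
  rw [sgn, sgn, sgn, e, ← hk, ← hk', negOnePow_intCast, negOnePow_intCast, negOnePow_intCast,
    zpow_add₀ (by simp)]

lemma sgn_mul_self {h : Idx K} (hh : Kbar K h) : sgn h * sgn h = 1 := by
  obtain ⟨k, hk⟩ := hh
  rw [sgn, ← hk, negOnePow_intCast, ← zpow_add₀ (by simp), ← two_mul, zpow_mul]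
  simp

lemma Kbar_neg {h : Idx K} : Kbar K (-h) ↔ Kbar K h := by
  constructor <;> rintro ⟨k, hk⟩ <;> refine ⟨-k, ?_⟩ <;> push_cast <;> rw [hk] <;>
    simp only [Prod.fst_neg, Prod.snd_neg] <;> ring

lemma Kbar_add {h h' : Idx K} (hh : Kbar K h) (hh' : Kbar K h') : Kbar K (h + h') := by
  obtain ⟨k, hk⟩ := hh
  obtain ⟨k', hk'⟩ := hh'
  refine ⟨k + k', ?_⟩
  push_cast
  rw [hk, hk']
  simp only [Prod.fst_add, Prod.snd_add]
  ring

lemma Kbar_int (i j : ℤ) : Kbar K ((i : K), (j : K)) := ⟨i - j, by push_cast; rfl⟩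

lemma Kbar_emb (j : ℕ × ℕ) : Kbar K (emb K j) := by
  simpa [emb] using Kbar_int (K := K) j.1 j.2

lemma sgn_emb (j : ℕ × ℕ) : sgn (emb K j) = (-1) ^ (j.1 + j.2) := by
  have e : (emb K j).1 - (emb K j).2 = ((j.1 - j.2 : ℤ) : K) := by push_cast; rfl
  rw [sgn, e, negOnePow_intCast, zpow_sub₀ (by simp), pow_add]
  rcases neg_one_pow_eq_or K j.2 with h | h <;> simp [h, div_neg]

/-- A functional on the space of formal expressions `z ^ (-(y - h) - 1) w ^ _ (z - w) ^ (-h)` of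
fixed total degree which is compatible with the relations
`(z - w) ^ (-h) = (z - w) (z - w) ^ (-h - 1)`. -/
structure Compat (φ : Idx K → Idx K → K) : Prop where
  fst : ∀ y h, φ (y + (1, 0)) h = φ y h - φ y (h - (1, 0))
  snd : ∀ y h, φ (y + (0, 1)) h = φ y h - φ y (h - (0, 1))

/-- coefficient in the expansion in `z > w` -/
def cfL (m y h : Idx K) : K := kap2 (-h) (m - y)

/-- coefficient in the expansion in `w > z` (zero for exponents outside of `𝕂̄`) -/
def cfR (m y h : Idx K) : K := if Kbar K h then sgn (-h) * kap2 (-h) (y - h - m) else 0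

/-- coefficient of the product with index `n` -/
def cfP (n y h : Idx K) : K := bin2 (h - 1 - y) (h - 1 - n)

lemma compat_cfL (m : Idx K) : Compat (cfL m) where
  fst y h := by
    have := kap_pascal (-h.1) (m.1 - y.1)
    simp only [cfL, kap2, Prod.fst_sub, Prod.snd_sub, Prod.fst_add, Prod.snd_add, Prod.fst_neg,
      Prod.snd_neg]
    rw [show m.1 - (y.1 + 1) = m.1 - y.1 - 1 by ring, show m.2 - (y.2 + 0) = m.2 - y.2 by ring,
      show -(h.1 - 1) = -h.1 + 1 by ring, show -(h.2 - 0) = -h.2 by ring, this]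
    ring
  snd y h := by
    have := kap_pascal (-h.2) (m.2 - y.2)
    simp only [cfL, kap2, Prod.fst_sub, Prod.snd_sub, Prod.fst_add, Prod.snd_add, Prod.fst_neg,
      Prod.snd_neg]
    rw [show m.2 - (y.2 + 1) = m.2 - y.2 - 1 by ring, show m.1 - (y.1 + 0) = m.1 - y.1 by ring,
      show -(h.2 - 1) = -h.2 + 1 by ring, show -(h.1 - 0) = -h.1 by ring, this]
    ring

lemma compat_cfP (n : Idx K) : Compat (cfP n) where
  fst y h := by
    have := bin_pascal (h.1 - 1 - 1 - y.1) (h.1 - 1 - n.1)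
    simp only [cfP, bin2, Prod.fst_sub, Prod.snd_sub, Prod.fst_add, Prod.snd_add, Prod.fst_one,
      Prod.snd_one]
    rw [show h.1 - 1 - (y.1 + 1) = h.1 - 1 - 1 - y.1 by ring,
      show h.2 - 1 - (y.2 + 0) = h.2 - 1 - y.2 by ring,
      show h.1 - 1 - y.1 = h.1 - 1 - 1 - y.1 + 1 by ring, this,
      show h.1 - 1 - 1 - n.1 = h.1 - 1 - n.1 - 1 by ring, show h.2 - 0 = h.2 by ring]
    ring
  snd y h := by
    have := bin_pascal (h.2 - 1 - 1 - y.2) (h.2 - 1 - n.2)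
    simp only [cfP, bin2, Prod.fst_sub, Prod.snd_sub, Prod.fst_add, Prod.snd_add, Prod.fst_one,
      Prod.snd_one]
    rw [show h.2 - 1 - (y.2 + 1) = h.2 - 1 - 1 - y.2 by ring,
      show h.1 - 1 - (y.1 + 0) = h.1 - 1 - y.1 by ring,
      show h.2 - 1 - y.2 = h.2 - 1 - 1 - y.2 + 1 by ring, this,
      show h.2 - 1 - 1 - n.2 = h.2 - 1 - n.2 - 1 by ring, show h.1 - 0 = h.1 by ring]
    ring

/-- the coefficient functional of `cfL` after exchanging `z` and `w` in `cfR` -/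
def cfS (m y h : Idx K) : K := sgn (-h) * cfR (-m) (h - y) h

lemma cfS_eq (m y h : Idx K) : cfS m y h = if Kbar K h then cfL m y h else 0 := by
  by_cases hh : Kbar K h
  · rw [cfS, cfR, if_pos hh, if_pos hh, ← mul_assoc, sgn_mul_self (Kbar_neg.2 hh), one_mul, cfL]
    congr 1
    abel
  · rw [cfS, cfR, if_neg hh, if_neg hh, mul_zero]

lemma Kbar_sub_int_iff {h : Idx K} (i j : ℤ) : Kbar K (h - ((i : K), (j : K))) ↔ Kbar K h := by
  constructor
  · intro hh
    simpa using Kbar_add hh (Kbar_int i j)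
  · intro hh
    rw [sub_eq_add_neg]
    exact Kbar_add hh (Kbar_neg.2 (Kbar_int i j))

lemma compat_cfR (m : Idx K) : Compat (cfR m) where
  fst y h := by
    have e : ((1 : K), (0 : K)) = (((1 : ℤ) : K), ((0 : ℤ) : K)) := by simp
    have hK : Kbar K (h - (1, 0)) ↔ Kbar K h := by rw [e]; exact Kbar_sub_int_iff 1 0
    by_cases hh : Kbar K h
    · have hs : sgn (-(h - (1, 0))) = - sgn (-h) := by
        rw [neg_sub, sub_eq_add_neg, add_comm, e, sgn_eq (Kbar_neg.2 hh)]
        simp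
      rw [cfR, cfR, cfR, if_pos hh, if_pos hh, if_pos (hK.2 hh), hs]
      have := kap_pascal (-h.1) (y.1 - h.1 - m.1 + 1)
      simp only [kap2, Prod.fst_sub, Prod.snd_sub, Prod.fst_add, Prod.snd_add, Prod.fst_neg,
        Prod.snd_neg]
      rw [show y.1 + 1 - h.1 - m.1 = y.1 - h.1 - m.1 + 1 by ring, this,
        show y.1 - h.1 - m.1 + 1 - 1 = y.1 - h.1 - m.1 by ring,
        show y.1 - (h.1 - 1) - m.1 = y.1 - h.1 - m.1 + 1 by ring,
        show -(h.1 - 1) = -h.1 + 1 by ring, add_zero, sub_zero]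
      ring
    · rw [cfR, cfR, cfR, if_neg hh, if_neg hh, if_neg (fun h' => hh (hK.1 h')), sub_zero]
  snd y h := by
    have e : ((0 : K), (1 : K)) = (((0 : ℤ) : K), ((1 : ℤ) : K)) := by simp
    have hK : Kbar K (h - (0, 1)) ↔ Kbar K h := by rw [e]; exact Kbar_sub_int_iff 0 1
    by_cases hh : Kbar K h
    · have hs : sgn (-(h - (0, 1))) = - sgn (-h) := by
        rw [neg_sub, sub_eq_add_neg, add_comm, e, sgn_eq (Kbar_neg.2 hh)]
        simp
      rw [cfR, cfR, cfR, if_pos hh, if_pos hh, if_pos (hK.2 hh), hs]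
      have := kap_pascal (-h.2) (y.2 - h.2 - m.2 + 1)
      simp only [kap2, Prod.fst_sub, Prod.snd_sub, Prod.fst_add, Prod.snd_add, Prod.fst_neg,
        Prod.snd_neg]
      rw [show y.2 + 1 - h.2 - m.2 = y.2 - h.2 - m.2 + 1 by ring, this,
        show y.2 - h.2 - m.2 + 1 - 1 = y.2 - h.2 - m.2 by ring,
        show y.2 - (h.2 - 1) - m.2 = y.2 - h.2 - m.2 + 1 by ring,
        show -(h.2 - 1) = -h.2 + 1 by ring, add_zero, sub_zero]
      ring
    · rw [cfR, cfR, cfR, if_neg hh, if_neg hh, if_neg (fun h' => hh (hK.1 h')), sub_zero]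

end Functionals

section Evaluation

variable {K : Type*} [Field K] [CharZero K] {M : Type*} [AddCommGroup M] [Module K M]

/-- the evaluation of a functional on formal expressions with coefficients in `M` -/
def evalF (φ : Idx K → Idx K → K) : (Idx K × Idx K →₀ M) →ₗ[K] M :=
  Finsupp.lsum K fun yh => φ yh.1 yh.2 • LinearMap.id

omit [CharZero K] in
lemma evalF_single (φ : Idx K → Idx K → K) (y h : Idx K) (v : M) :
    evalF φ (Finsupp.single (y, h) v) = φ y h • v := by
  simp [evalF]

omit [CharZero K] in
lemma evalF_apply (φ : Idx K → Idx K → K) (X : Idx K × Idx K →₀ M) :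
    evalF φ X = ∑ yh ∈ X.support, φ yh.1 yh.2 • X yh := by
  simp [evalF, Finsupp.sum]

lemma kap_neg_mul (x : K) (j : ℕ) :
    x * kap (-x) (j : K) = (j + 1) * kap (-x) ((j + 1 : ℕ) : K) - j * kap (-x) (j : K) := by
  rw [kap_natCast, kap_natCast, pow_succ]
  linear_combination (-1) ^ j * gchoose_succ (-x) j

lemma kap2_independent (S : Finset (Idx K)) : ∀ v : Idx K → M,
    (∀ j : ℕ × ℕ, ∑ l ∈ S, kap2 (-l) (emb K j) • v l = 0) → ∀ l ∈ S, v l = 0 := by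
  induction S using Finset.induction_on with
  | empty => simp
  | insert μ S hμ ih =>
    intro v hv
    have h1 : ∀ l ∈ S, (l.1 - μ.1) • v l = 0 := by
      refine ih (fun l => (l.1 - μ.1) • v l) fun j => ?_
      have e : ∀ l : Idx K, kap2 (-l) (emb K j) • (l.1 - μ.1) • v l =
          ((j.1 : K) + 1) • kap2 (-l) (emb K (j.1 + 1, j.2)) • v l -
            ((j.1 : K) + μ.1) • kap2 (-l) (emb K j) • v l := by
        intro l
        simp only [smul_smul, ← sub_smul]
        congr 1
        have := kap_neg_mul l.1 j.1
        simp only [kap2, emb, Prod.fst_neg, Prod.snd_neg]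
        linear_combination kap (-l.2) (j.2 : K) * this
      have := congrArg₂ (· - ·) (congrArg (((j.1 : K) + 1) • ·) (hv (j.1 + 1, j.2)))
        (congrArg (((j.1 : K) + μ.1) • ·) (hv j))
      simp only [Finset.smul_sum, ← Finset.sum_sub_distrib, ← e, smul_zero, sub_zero] at this
      rwa [Finset.sum_insert hμ, sub_self, zero_smul, smul_zero, zero_add] at this
    have h2 : ∀ l ∈ S, (l.2 - μ.2) • v l = 0 := by
      refine ih (fun l => (l.2 - μ.2) • v l) fun j => ?_
      have e : ∀ l : Idx K, kap2 (-l) (emb K j) • (l.2 - μ.2) • v l =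
          ((j.2 : K) + 1) • kap2 (-l) (emb K (j.1, j.2 + 1)) • v l -
            ((j.2 : K) + μ.2) • kap2 (-l) (emb K j) • v l := by
        intro l
        simp only [smul_smul, ← sub_smul]
        congr 1
        have := kap_neg_mul l.2 j.2
        simp only [kap2, emb, Prod.fst_neg, Prod.snd_neg]
        linear_combination kap (-l.1) (j.1 : K) * this
      have := congrArg₂ (· - ·) (congrArg (((j.2 : K) + 1) • ·) (hv (j.1, j.2 + 1)))
        (congrArg (((j.2 : K) + μ.2) • ·) (hv j))
      simp only [Finset.smul_sum, ← Finset.sum_sub_distrib, ← e, smul_zero, sub_zero] at this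
      rwa [Finset.sum_insert hμ, sub_self, zero_smul, smul_zero, zero_add] at this
    have h3 : ∀ l ∈ S, v l = 0 := by
      intro l hl
      by_contra hne
      have a := (smul_eq_zero.1 (h1 l hl)).resolve_right hne
      have b := (smul_eq_zero.1 (h2 l hl)).resolve_right hne
      have : l = μ := Prod.ext (sub_eq_zero.1 a) (sub_eq_zero.1 b)
      exact hμ (this ▸ hl)
    intro l hl
    rcases Finset.mem_insert.1 hl with rfl | hl
    · have h0 := hv 0
      rw [Finset.sum_insert hμ, Finset.sum_eq_zero (fun x hx => by rw [h3 x hx, smul_zero]),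
        add_zero, kap2_emb] at h0
      simpa [gchoose_zero] using h0
    · exact h3 l hl

lemma exists_base_shift (y0 h : Idx K) (v : M) (k : ℕ × ℕ) :
    ∃ X : Idx K →₀ M, ∀ φ : Idx K → Idx K → K, Compat φ →
      φ (y0 + emb K k) h • v =
        Finsupp.lsum K (fun l => φ y0 l • (LinearMap.id : M →ₗ[K] M)) X := by
  have key : ∀ k1 k2 : ℕ, ∀ h : Idx K, ∃ X : Idx K →₀ M, ∀ φ : Idx K → Idx K → K, Compat φ →
      φ (y0 + emb K (k1, k2)) h • v =
        Finsupp.lsum K (fun l => φ y0 l • (LinearMap.id : M →ₗ[K] M)) X := by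
    intro k1 k2
    induction k1 with
    | zero =>
      induction k2 with
      | zero =>
        intro h
        refine ⟨Finsupp.single h v, fun φ _ => ?_⟩
        have : emb K (0, 0) = 0 := emb_zero
        simp [this]
      | succ k2 ih =>
        intro h
        obtain ⟨X, hX⟩ := ih h
        obtain ⟨X', hX'⟩ := ih (h - (0, 1))
        refine ⟨X - X', fun φ hφ => ?_⟩
        rw [map_sub, ← hX φ hφ, ← hX' φ hφ, ← sub_smul, ← hφ.snd]
        congr 2
        ext <;> simp [emb, add_assoc]
    | succ k1 ih =>
      intro h
      obtain ⟨X, hX⟩ := ih h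
      obtain ⟨X', hX'⟩ := ih (h - (1, 0))
      refine ⟨X - X', fun φ hφ => ?_⟩
      rw [map_sub, ← hX φ hφ, ← hX' φ hφ, ← sub_smul, ← hφ.fst]
      congr 2
      ext <;> simp [emb, add_assoc]
  exact key k.1 k.2 h

end Evaluation

section Independence

variable {K : Type*} [Field K] [CharZero K] {M : Type*} [AddCommGroup M] [Module K M]

omit [CharZero K] in
lemma evalF_congr {φ ψ : Idx K → Idx K → K} {X : Idx K × Idx K →₀ M}
    (h : ∀ yh ∈ X.support, φ yh.1 yh.2 = ψ yh.1 yh.2) : evalF φ X = evalF ψ X := by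
  rw [evalF_apply, evalF_apply]
  exact Finset.sum_congr rfl fun yh hyh => by rw [h yh hyh]

omit [CharZero K] in
lemma evalF_map {N : Type*} [AddCommGroup N] [Module K N] (f : M →ₗ[K] N)
    (φ : Idx K → Idx K → K) (X : Idx K × Idx K →₀ M) :
    evalF φ (Finsupp.mapRange.linearMap f X) = f (evalF φ X) := by
  induction X using Finsupp.induction_linear with
  | zero => simp
  | add X Y hX hY => simp only [map_add, hX, hY]
  | single yh v =>
    obtain ⟨y, h⟩ := yh
    simp [evalF_single]

/-- the reflection of formal expressions which exchanges the roles of `z` and `w` -/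
def reflect : (Idx K × Idx K →₀ M) →ₗ[K] (Idx K × Idx K →₀ M) :=
  Finsupp.lsum K fun yh => (sgn (-yh.2) : K) • Finsupp.lsingle (yh.2 - yh.1, yh.2)

lemma evalF_reflect (φ : Idx K → Idx K → K) (X : Idx K × Idx K →₀ M) :
    evalF φ (reflect X) = evalF (fun y h => sgn (-h) * φ (h - y) h) X := by
  induction X using Finsupp.induction_linear with
  | zero => simp
  | add X Y hX hY => simp only [map_add, hX, hY]
  | single yh v =>
    obtain ⟨y, h⟩ := yh
    rw [evalF_single]
    simp [reflect, evalF_single, mul_smul, smul_comm (φ (h - y) h)]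

lemma exists_common_base (S : Finset (Idx K)) (y1 : Idx K)
    (hS : ∀ y ∈ S, IsIntPair K (y - y1)) : ∃ y0, ∀ y ∈ S, ∃ k, y0 + emb K k = y := by
  have h1 : ∀ y, ∃ i j : ℤ, y ∈ S → (i : K) = (y - y1).1 ∧ (j : K) = (y - y1).2 := by
    intro y
    by_cases hy : y ∈ S
    · obtain ⟨⟨i, hi⟩, ⟨j, hj⟩⟩ := hS y hy
      exact ⟨i, j, fun _ => ⟨hi, hj⟩⟩
    · exact ⟨0, 0, fun h => absurd h hy⟩
  choose i j hij using h1
  refine ⟨y1 - emb K (∑ y ∈ S, (i y).natAbs, ∑ y ∈ S, (j y).natAbs), fun y hy => ?_⟩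
  obtain ⟨h1, h2⟩ := hij y hy
  have a1 : (i y).natAbs ≤ ∑ y ∈ S, (i y).natAbs :=
    Finset.single_le_sum (f := fun y => (i y).natAbs) (fun _ _ => Nat.zero_le _) hy
  have a2 : (j y).natAbs ≤ ∑ y ∈ S, (j y).natAbs :=
    Finset.single_le_sum (f := fun y => (j y).natAbs) (fun _ _ => Nat.zero_le _) hy
  obtain ⟨k1, hk1⟩ : ∃ k1 : ℕ, (k1 : ℤ) = ((∑ y ∈ S, (i y).natAbs : ℕ) : ℤ) + i y :=
    ⟨(((∑ y ∈ S, (i y).natAbs : ℕ) : ℤ) + i y).toNat, Int.toNat_of_nonneg (by omega)⟩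
  obtain ⟨k2, hk2⟩ : ∃ k2 : ℕ, (k2 : ℤ) = ((∑ y ∈ S, (j y).natAbs : ℕ) : ℤ) + j y :=
    ⟨(((∑ y ∈ S, (j y).natAbs : ℕ) : ℤ) + j y).toNat, Int.toNat_of_nonneg (by omega)⟩
  have b1 := congrArg (Int.cast : ℤ → K) hk1
  have b2 := congrArg (Int.cast : ℤ → K) hk2
  rw [Int.cast_natCast, Int.cast_add, Int.cast_natCast, h1] at b1
  rw [Int.cast_natCast, Int.cast_add, Int.cast_natCast, h2] at b2
  refine ⟨(k1, k2), Prod.ext ?_ ?_⟩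
  · simp only [emb, Prod.fst_add, Prod.fst_sub] at *
    rw [b1]; ring
  · simp only [emb, Prod.snd_add, Prod.snd_sub] at *
    rw [b2]; ring

lemma evalF_eq_zero_of_cfL_of_class {X : Idx K × Idx K →₀ M} (y1 : Idx K)
    (hc : ∀ yh ∈ X.support, IsIntPair K (yh.1 - y1))
    (h0 : ∀ m, evalF (cfL m) X = 0) {φ : Idx K → Idx K → K} (hφ : Compat φ) :
    evalF φ X = 0 := by
  obtain ⟨y0, hy0⟩ := exists_common_base (X.support.image Prod.fst) y1 (by
    intro y hy
    obtain ⟨yh, hyh, rfl⟩ := Finset.mem_image.1 hy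
    exact hc yh hyh)
  have h1 : ∀ yh : Idx K × Idx K, ∃ C : Idx K →₀ M, yh ∈ X.support →
      ∀ φ : Idx K → Idx K → K, Compat φ → φ yh.1 yh.2 • X yh =
        Finsupp.lsum K (fun l => φ y0 l • (LinearMap.id : M →ₗ[K] M)) C := by
    intro yh
    by_cases hyh : yh ∈ X.support
    · obtain ⟨k, hk⟩ := hy0 yh.1 (Finset.mem_image_of_mem _ hyh)
      obtain ⟨C, hC⟩ := exists_base_shift y0 yh.2 (X yh) k
      refine ⟨C, fun _ => ?_⟩
      rwa [hk] at hC
    · exact ⟨0, fun h => absurd h hyh⟩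
  choose C hC using h1
  have h2 : ∀ φ : Idx K → Idx K → K, Compat φ → evalF φ X =
      Finsupp.lsum K (fun l => φ y0 l • (LinearMap.id : M →ₗ[K] M)) (∑ yh ∈ X.support, C yh) := by
    intro φ hφ
    rw [map_sum, evalF_apply]
    exact Finset.sum_congr rfl fun yh hyh => hC yh hyh φ hφ
  have h3 : ∑ yh ∈ X.support, C yh = 0 := by
    set D := ∑ yh ∈ X.support, C yh
    have := kap2_independent D.support D fun j => by
      have e := (h2 _ (compat_cfL (y0 + emb K j))).symm.trans (h0 _)
      rw [← e]
      simp [Finsupp.sum, cfL]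
    ext l
    by_cases hl : l ∈ D.support
    · exact this l hl
    · exact Finsupp.notMem_support_iff.1 hl
  rw [h2 φ hφ, h3, map_zero]

lemma evalF_eq_zero_of_cfL {φ : Idx K → Idx K → K} (hφ : Compat φ)
    (X : Idx K × Idx K →₀ M) (h0 : ∀ m, evalF (cfL m) X = 0) : evalF φ X = 0 := by
  induction hn : X.support.card using Nat.strong_induction_on generalizing X with
  | _ n ih =>
    subst hn
    rcases X.support.eq_empty_or_nonempty with he | ⟨yh1, hyh1⟩
    · rw [Finsupp.support_eq_empty.1 he, map_zero]
    set p : Idx K × Idx K → Prop := fun yh => IsIntPair K (yh.1 - yh1.1) with hp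
    have hX : X.filter p + X.filter (fun yh => ¬ p yh) = X := Finsupp.filter_add_filter_not X p
    have hp1 : p yh1 := by
      simp only [hp, sub_self]
      exact ⟨⟨0, by simp⟩, ⟨0, by simp⟩⟩
    have key : ∀ m, IsIntPair K (m - yh1.1) → ∀ yh, ¬ p yh → cfL m yh.1 yh.2 = 0 := by
      intro m hm yh hyh
      by_contra hne
      obtain ⟨k, hk⟩ := exists_of_kap2_ne hne
      apply hyh
      obtain ⟨⟨i, hi⟩, ⟨j, hj⟩⟩ := hm
      have hk1 := congrArg Prod.fst hk
      have hk2 := congrArg Prod.snd hk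
      simp only [emb, Prod.fst_sub, Prod.snd_sub] at hk1 hk2 hi hj
      refine ⟨⟨i - k.1, ?_⟩, ⟨j - k.2, ?_⟩⟩
      · push_cast
        rw [hi, hk1, Prod.fst_sub]; ring
      · push_cast
        rw [hj, hk2, Prod.snd_sub]; ring
    have key' : ∀ m, ¬ IsIntPair K (m - yh1.1) → ∀ yh, p yh → cfL m yh.1 yh.2 = 0 := by
      intro m hm yh hyh
      by_contra hne
      obtain ⟨k, hk⟩ := exists_of_kap2_ne hne
      apply hm
      obtain ⟨⟨i, hi⟩, ⟨j, hj⟩⟩ := hyh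
      have hk1 := congrArg Prod.fst hk
      have hk2 := congrArg Prod.snd hk
      simp only [emb, Prod.fst_sub, Prod.snd_sub] at hk1 hk2 hi hj
      refine ⟨⟨i + k.1, ?_⟩, ⟨j + k.2, ?_⟩⟩
      · push_cast
        rw [hi, hk1, Prod.fst_sub]; ring
      · push_cast
        rw [hj, hk2, Prod.snd_sub]; ring
    have h1 : ∀ m, evalF (cfL m) (X.filter p) = 0 := by
      intro m
      by_cases hm : IsIntPair K (m - yh1.1)
      · have : evalF (cfL m) (X.filter (fun yh => ¬ p yh)) = 0 := by
          rw [evalF_apply]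
          refine Finset.sum_eq_zero fun yh hyh => ?_
          rw [key m hm yh (by simpa using (Finset.mem_filter.1 hyh).2), zero_smul]
        rw [← h0 m, ← hX, map_add, this, add_zero, hX]
      · rw [evalF_apply]
        refine Finset.sum_eq_zero fun yh hyh => ?_
        rw [key' m hm yh (by simpa using (Finset.mem_filter.1 hyh).2), zero_smul]
    have h2 : ∀ m, evalF (cfL m) (X.filter fun yh => ¬ p yh) = 0 := by
      intro m
      have := h0 m
      rwa [← hX, map_add, h1, zero_add] at this
    rw [← hX, map_add, evalF_eq_zero_of_cfL_of_class yh1.1 _ h1 hφ, zero_add]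
    · refine ih _ ?_ _ h2 rfl
      refine Finset.card_lt_card ⟨fun yh hyh => (Finset.mem_filter.1 hyh).1, fun hs => ?_⟩
      exact absurd hp1 (Finset.mem_filter.1 (hs hyh1)).2
    · intro yh hyh
      exact (Finset.mem_filter.1 hyh).2

lemma evalF_eq_of_cfL {φ : Idx K → Idx K → K} (hφ : Compat φ)
    {X X' : Idx K × Idx K →₀ M} (h0 : ∀ m, evalF (cfL m) X = evalF (cfL m) X') :
    evalF φ X = evalF φ X' := by
  rw [← sub_eq_zero, ← map_sub]
  refine evalF_eq_zero_of_cfL hφ _ fun m => ?_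
  rw [map_sub, h0, sub_self]

variable (K M) in
/-- the formal expressions with exponents in `𝕂̄` -/
def KbarExp : Submodule K (Idx K × Idx K →₀ M) := Finsupp.supported M K {yh | Kbar K yh.2}

lemma single_mem_KbarExp {y h : Idx K} (hh : Kbar K h) (v : M) :
    Finsupp.single (y, h) v ∈ KbarExp K M :=
  Finsupp.single_mem_supported K v hh

lemma evalF_cfL_eq_of_cfR {X X' : Idx K × Idx K →₀ M} (hX : X ∈ KbarExp K M)
    (hX' : X' ∈ KbarExp K M) (h0 : ∀ m, evalF (cfR m) X = evalF (cfR m) X') (m : Idx K) :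
    evalF (cfL m) X = evalF (cfL m) X' := by
  have hY := sub_mem hX hX'
  rw [← sub_eq_zero, ← map_sub]
  replace h0 : ∀ m, evalF (cfR m) (X - X') = 0 := fun m => by rw [map_sub, h0, sub_self]
  generalize X - X' = Y at *
  have h1 : ∀ m, evalF (cfL m) (reflect Y) = 0 := by
    intro m
    rw [evalF_reflect, ← h0 (-m)]
    refine evalF_congr fun yh hyh => ?_
    have hk : Kbar K yh.2 := hY hyh
    rw [cfR, if_pos hk, cfL]
    congr 2
    abel
  rw [← evalF_eq_zero_of_cfL (compat_cfR (-m)) _ h1, evalF_reflect]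
  refine evalF_congr fun yh hyh => ?_
  have hk : Kbar K yh.2 := hY hyh
  have := cfS_eq m yh.1 yh.2
  rw [if_pos hk] at this
  exact this.symm

end Independence

section TwoVariables

variable {K : Type*} [Field K] [CharZero K] {M : Type*} [AddCommGroup M] [Module K M]

lemma finsum_comp_of_injective {α β N : Type*} [AddCommMonoid N] {g : α → β}
    (hg : Function.Injective g) (F : β → N) (h0 : ∀ b, (¬ ∃ a, g a = b) → F b = 0) :
    ∑ᶠ a, F (g a) = ∑ᶠ b, F b := by
  rw [← finsum_mem_range hg]
  refine finsum_congr fun b => ?_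
  by_cases hb : b ∈ Set.range g
  · simp [hb]
  · rw [h0 b hb]; simp

omit [CharZero K] in
lemma isNegInt_iff {x : Idx K} :
    (IsNegInt K x.1 ∧ IsNegInt K x.2) ↔ ∃ i, x = -1 - emb K i := by
  constructor
  · rintro ⟨⟨k, hk, hk'⟩, ⟨l, hl, hl'⟩⟩
    obtain ⟨i, rfl⟩ : ∃ i : ℕ, k = -1 - i := ⟨(-1 - k).toNat, by omega⟩
    obtain ⟨j, rfl⟩ : ∃ i : ℕ, l = -1 - i := ⟨(-1 - l).toNat, by omega⟩
    refine ⟨(i, j), Prod.ext ?_ ?_⟩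
    · rw [← hk']; simp [emb]
    · rw [← hl']; simp [emb]
  · rintro ⟨i, rfl⟩
    refine ⟨⟨-1 - i.1, by omega, by simp [emb]⟩, ⟨-1 - i.2, by omega, by simp [emb]⟩⟩

lemma InLat2.finite_line {c : Dist2 K M} (hc : InLat2 K M c) (t : Idx K) :
    {p | c p (t - p) ≠ 0}.Finite := by
  obtain ⟨S, hS⟩ := hc
  refine ((S.biUnion fun m => (pairBelow (m.1 + m.2 - t - 1 - 1)).image
    fun i => m.1 - 1 - emb K i).finite_toSet).subset fun p hp => ?_
  obtain ⟨m, hm, h1, h2⟩ := hS _ _ hp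
  obtain ⟨i, hi⟩ := isNegInt_iff (x := p - m.1).1 h1
  obtain ⟨j, hj⟩ := isNegInt_iff (x := t - p - m.2).1 h2
  simp only [Finset.coe_biUnion, Set.mem_iUnion, Finset.mem_coe, Finset.mem_image]
  refine ⟨m, hm, i, mem_pairBelow.2 ⟨j, ?_⟩, ?_⟩
  · linear_combination hi + hj
  · linear_combination -hi

/-- the formal expression of total degree `s` given by `(z - w) ^ (-h) c(z, w)` -/
def lineData (h : Idx K) (c : Dist2 K M) (s : Idx K) : Idx K × Idx K →₀ M :=
  ∑ᶠ p : Idx K, Finsupp.single (p + h, h) (c p (s - h - p))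

lemma InLat2.finite_support_lineData {c : Dist2 K M} (hc : InLat2 K M c) (h s : Idx K) :
    (Function.support fun p : Idx K =>
      (Finsupp.single (p + h, h) (c p (s - h - p)) : Idx K × Idx K →₀ M)).Finite := by
  refine (hc.finite_line (s - h)).subset fun p hp hn => hp ?_
  simp only [hn, Finsupp.single_zero]

lemma evalF_lineData {c : Dist2 K M} (hc : InLat2 K M c) (h s : Idx K)
    (φ : Idx K → Idx K → K) :
    evalF φ (lineData h c s) = ∑ᶠ p, φ (p + h) h • c p (s - h - p) := by
  rw [lineData, ← LinearMap.toAddMonoidHom_coe,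
    AddMonoidHom.map_finsum _ (hc.finite_support_lineData h s)]
  exact finsum_congr fun p => evalF_single φ _ _ _

lemma lineData_mem (c : Dist2 K M) {h : Idx K} (hh : Kbar K h) (s : Idx K) :
    lineData h c s ∈ KbarExp K M :=
  finsum_induction (· ∈ KbarExp K M) (zero_mem _) (fun _ _ => add_mem)
    fun _ => single_mem_KbarExp hh _

lemma zwPow_eq {c : Dist2 K M} (hc : InLat2 K M c) (h m k : Idx K) :
    zwPow K M (-h) c m k = evalF (cfL m) (lineData h c (m + k)) := by
  rw [evalF_lineData hc, zwPow, ← finsum_comp_of_injective (g := fun i => m - h - emb K i)]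
  · refine finsum_congr fun i => ?_
    have e1 : m - (m - h - emb K i + h) = emb K i := by ring
    rw [cfL, e1, kap2_emb]
    congr 2 <;> ext <;> simp [emb] <;> ring
  · intro i j hij
    exact emb_injective (sub_right_injective hij)
  · intro p hp
    rw [cfL]
    by_cases h0 : kap2 (-h) (m - (p + h)) = 0
    · rw [h0, zero_smul]
    · obtain ⟨i, hi⟩ := exists_of_kap2_ne h0
      exact absurd ⟨i, by linear_combination -hi⟩ hp

lemma zwPowW_eq {c : Dist2 K M} (hc : InLat2 K M c) {h : Idx K} (hh : Kbar K h) (m k : Idx K) :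
    zwPowW K M (-h) c m k = evalF (cfR m) (lineData h c (m + k)) := by
  rw [evalF_lineData hc, zwPowW, ← finsum_comp_of_injective (g := fun i => m + emb K i)]
  · refine finsum_congr fun i => ?_
    have e1 : m + emb K i + h - h - m = emb K i := by ring
    rw [cfR, if_pos hh, e1, kap2_emb, ← mul_assoc, ← mul_assoc, sgn]
    congr 2
    · ext <;> simp [emb] <;> ring
  · intro i j hij
    exact emb_injective (add_right_injective _ hij)
  · intro p hp
    rw [cfR, if_pos hh]
    by_cases h0 : kap2 (-h) (p + h - h - m) = 0
    · rw [h0, mul_zero, zero_smul]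
    · obtain ⟨i, hi⟩ := exists_of_kap2_ne h0
      exact absurd ⟨i, by linear_combination hi⟩ hp

lemma iterate_d1z (c : Dist2 K M) (j : ℕ) (n k : Idx K) :
    ((j.factorial : K)⁻¹ • (d1z K M)^[j] c) n k =
      gchoose K ((j : K) - 1 - n.1) j • c (n.1 - j, n.2) k := by
  induction j generalizing n with
  | zero => simp [gchoose_zero]
  | succ j ih =>
    have h1 := ih (n.1 - 1, n.2)
    have h2 := gchoose_succ ((j : K) - n.1) j
    have hj : (j : K) + 1 ≠ 0 := by exact_mod_cast j.succ_ne_zero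
    rw [Function.iterate_succ_apply']
    simp only [Pi.smul_apply, d1z] at h1 ⊢
    rw [smul_comm, Nat.factorial_succ, Nat.cast_mul, mul_inv, mul_smul, h1, smul_smul, smul_smul]
    congr 1
    · push_cast
      rw [show (j : K) - 1 - (n.1 - 1) = j - n.1 by ring,
        show (j : K) + 1 - 1 - n.1 = j - n.1 by ring]
      field_simp
      linear_combination -h2
    · congr 2
      push_cast
      ring

lemma iterate_d1zb (c : Dist2 K M) (j : ℕ) (n k : Idx K) :
    ((j.factorial : K)⁻¹ • (d1zb K M)^[j] c) n k =
      gchoose K ((j : K) - 1 - n.2) j • c (n.1, n.2 - j) k := by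
  induction j generalizing n with
  | zero => simp [gchoose_zero]
  | succ j ih =>
    have h1 := ih (n.1, n.2 - 1)
    have h2 := gchoose_succ ((j : K) - n.2) j
    have hj : (j : K) + 1 ≠ 0 := by exact_mod_cast j.succ_ne_zero
    rw [Function.iterate_succ_apply']
    simp only [Pi.smul_apply, d1zb] at h1 ⊢
    rw [smul_comm, Nat.factorial_succ, Nat.cast_mul, mul_inv, mul_smul, h1, smul_smul, smul_smul]
    congr 1
    · push_cast
      rw [show (j : K) - 1 - (n.2 - 1) = j - n.2 by ring,
        show (j : K) + 1 - 1 - n.2 = j - n.2 by ring]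
      field_simp
      linear_combination -h2
    · congr 2
      push_cast
      ring

lemma ddPow2_apply (e : Idx K) (c : Dist2 K M) (n k : Idx K) :
    ddPow2 K M e c n k = bin2 (e - 1 - n) e • c (n - e) k := by
  have h1 : ∀ (x : K) (c : Dist2 K M) (n k : Idx K), dPow K (d1z K M) x c n k =
      bin (x - 1 - n.1) x • c (n.1 - x, n.2) k := by
    intro x c n k
    by_cases hx : ∃ j : ℕ, (j : K) = x
    · rw [dPow, dif_pos hx, iterate_d1z, hx.choose_spec]
      conv_rhs => rw [← hx.choose_spec, bin_natCast, hx.choose_spec]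
    · rw [dPow, dif_neg hx, bin, natExt_of_not hx, zero_smul]; rfl
  have h2 : ∀ (x : K) (c : Dist2 K M) (n k : Idx K), dPow K (d1zb K M) x c n k =
      bin (x - 1 - n.2) x • c (n.1, n.2 - x) k := by
    intro x c n k
    by_cases hx : ∃ j : ℕ, (j : K) = x
    · rw [dPow, dif_pos hx, iterate_d1zb, hx.choose_spec]
      conv_rhs => rw [← hx.choose_spec, bin_natCast, hx.choose_spec]
    · rw [dPow, dif_neg hx, bin, natExt_of_not hx, zero_smul]; rfl
  rw [ddPow2, h1, h2, smul_smul]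
  rfl

lemma diag_ddPow2_eq {c : Dist2 K M} (hc : InLat2 K M c) (h n l : Idx K) :
    diag K M (ddPow2 K M (h - 1 - n) c) l = evalF (cfP n) (lineData h c (n + l)) := by
  rw [evalF_lineData hc, diag]
  refine Eq.trans (finsum_congr fun m => ?_) (finsum_comp_equiv (Equiv.subRight (h - 1 - n)))
  rw [ddPow2_apply, Equiv.subRight_apply, cfP,
    show h - 1 - n - 1 - m = h - 1 - (m - (h - 1 - n) + h) by ring]
  congr 2
  ext <;> simp <;> ring

lemma InLat2.finite_zwPow {c : Dist2 K M} (hc : InLat2 K M c) (a k s : Idx K) :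
    {m | zwPow K M a c m k ≠ 0 ∧ ∃ j, emb K j = m - s}.Finite := by
  obtain ⟨S, hS⟩ := hc
  refine ((S.biUnion fun q => (pairBelow (q.1 + q.2 - a - k - 1 - 1 - s)).image
    fun i => q.1 + q.2 - a - k - 1 - 1 - emb K i).finite_toSet).subset ?_
  rintro m ⟨hm, j, hj⟩
  obtain ⟨i, hi⟩ : ∃ i : ℕ × ℕ,
      c (m.1 + a.1 - i.1, m.2 + a.2 - i.2) (k.1 + i.1, k.2 + i.2) ≠ 0 := by
    by_contra! hn
    exact hm (by simp [zwPow, hn])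
  obtain ⟨q, hq, h1, h2⟩ := hS _ _ hi
  obtain ⟨i1, h1⟩ := isNegInt_iff (x := m + a - emb K i - q.1).1 h1
  obtain ⟨i2, h2⟩ := isNegInt_iff (x := k + emb K i - q.2).1 h2
  simp only [Finset.coe_biUnion, Set.mem_iUnion, Finset.mem_coe, Finset.mem_image]
  refine ⟨q, hq, i1 + i2, mem_pairBelow.2 ⟨j, ?_⟩, ?_⟩
  · rw [emb_add]
    linear_combination hj + h1 + h2
  · rw [emb_add]
    linear_combination - h1 - h2

variable {E : Type*} [AddCommGroup E] [Module K E]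

lemma IsOPE.exists_data {pa pb : ZMod 2} {a b : EDist1 K E} {r : ℕ}
    {c : Fin r → EDist2 K E} {h : Fin r → Idx K} (H : IsOPE K E pa pb a b c h)
    (v : E) (s : Idx K) :
    ∃ X ∈ KbarExp K E,
      (∀ m k, m + k = s → a m (b k v) = evalF (cfL m) X) ∧
      (∀ m k, m + k = s → koszul K pa pb • b k (a m v) = evalF (cfR m) X) ∧
      ∀ n l, n + l = s → prodAt K E c h n v l = evalF (cfP n) X := by
  obtain ⟨h1, h2, h3, h4⟩ := H
  refine ⟨∑ i, lineData (h i) (ev2 K E (c i) v) s, sum_mem fun i _ => lineData_mem _ (h1 i) _,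
    ?_, ?_, ?_⟩
  · rintro m k rfl
    rw [h3, map_sum]
    exact Finset.sum_congr rfl fun i _ => zwPow_eq (h2 i v) _ _ _
  · rintro m k rfl
    rw [h4, map_sum]
    exact Finset.sum_congr rfl fun i _ => zwPowW_eq (h2 i v) (h1 i) _ _
  · rintro n l rfl
    rw [prodAt, map_sum]
    exact Finset.sum_congr rfl fun i _ => diag_ddPow2_eq (h2 i v) _ _ _

end TwoVariables

section ThreeVariables

variable {K : Type*} [Field K] [CharZero K] {M : Type*} [AddCommGroup M] [Module K M]

def pair01 : Pairs 3 := ⟨(0, 1), by decide⟩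

def pair02 : Pairs 3 := ⟨(0, 2), by decide⟩

def pair12 : Pairs 3 := ⟨(1, 2), by decide⟩

lemma univ_pairs_three : (Finset.univ : Finset (Pairs 3)) = {pair01, pair02, pair12} := by
  decide

lemma prod_pairs_three {N : Type*} [CommMonoid N] (f : Pairs 3 → N) :
    ∏ p, f p = f pair01 * (f pair02 * f pair12) := by
  rw [univ_pairs_three, Finset.prod_insert (by decide), Finset.prod_insert (by decide),
    Finset.prod_singleton]

lemma sum_pairs_three {N : Type*} [AddCommMonoid N] (f : Pairs 3 → N) :
    ∑ p, f p = f pair01 + (f pair02 + f pair12) := by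
  rw [univ_pairs_three, Finset.sum_insert (by decide), Finset.sum_insert (by decide),
    Finset.sum_singleton]

lemma pairs_three_ext {β : Type*} {κ κ' : Pairs 3 → β} (h1 : κ pair01 = κ' pair01)
    (h2 : κ pair02 = κ' pair02) (h3 : κ pair12 = κ' pair12) : κ = κ' := by
  funext q
  have hq : q ∈ (Finset.univ : Finset (Pairs 3)) := Finset.mem_univ q
  rw [univ_pairs_three] at hq
  simp only [Finset.mem_insert, Finset.mem_singleton] at hq
  rcases hq with rfl | rfl | rfl <;> assumption

/-- the permutation moving the third entry to the front -/
def rot : Equiv.Perm (Fin 3) where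
  toFun := ![2, 0, 1]
  invFun := ![1, 2, 0]
  left_inv := by decide
  right_inv := by decide

lemma InLatN.finite_plane {C : DistN K M 3} (hC : InLatN K M C) (t : Idx K) :
    {P | C P ≠ 0 ∧ P 0 + P 1 + P 2 = t}.Finite := by
  obtain ⟨S, hS⟩ := hC
  let B : (Fin 3 → Idx K) → Finset (ℕ × ℕ) := fun m => pairBelow (m 0 + m 1 + m 2 - 3 - t)
  refine ((S.biUnion fun m => (Fintype.piFinset fun _ : Fin 3 => B m).image
    fun i => fun l => m l - 1 - emb K (i l)).finite_toSet).subset ?_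
  rintro P ⟨hP, ht⟩
  obtain ⟨m, hm, h⟩ := hS P hP
  have h' : ∀ l, ∃ i, P l - m l = -1 - emb K i := fun l =>
    isNegInt_iff (x := P l - m l).1 (h l)
  choose i hi using h'
  simp only [Finset.coe_biUnion, Set.mem_iUnion, Finset.mem_coe, Finset.mem_image]
  refine ⟨m, hm, i, Fintype.mem_piFinset.2 fun l => mem_pairBelow.2 ?_, ?_⟩
  · have e : emb K (i 0) + emb K (i 1) + emb K (i 2) = m 0 + m 1 + m 2 - 3 - t := by
      linear_combination hi 0 + hi 1 + hi 2 - ht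
    fin_cases l
    · exact ⟨i 1 + i 2, by rw [emb_add, ← e]; simp [add_assoc]⟩
    · exact ⟨i 0 + i 2, by rw [emb_add, ← e]; simp; ring⟩
    · exact ⟨i 0 + i 1, by rw [emb_add, ← e]; simp; ring⟩
  · funext l
    linear_combination -hi l

lemma finsum_pairs_three (C : DistN K M 3) (S : Finset (Fin 3 → Idx K)) (t a b d : Idx K)
    (hS : ∀ P, P ∈ S ↔ C P ≠ 0 ∧ P 0 + P 1 + P 2 = t)
    (N : (Fin 3 → Idx K) → Idx K) (D : (Fin 3 → Idx K) → ℕ × ℕ → Idx K) (w : K)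
    (g : (Pairs 3 → ℕ × ℕ) → Fin 3 → Idx K)
    (hg : ∀ κ P, g κ = P ↔ P 0 + P 1 + P 2 = t ∧
      emb K (κ pair02) + emb K (κ pair12) = N P ∧ emb K (κ pair01) = D P (κ pair02)) :
    ∑ᶠ κ, (w * (kap2 a (emb K (κ pair01)) * (kap2 b (emb K (κ pair02)) *
        kap2 d (emb K (κ pair12))))) • C (g κ) =
      ∑ P ∈ S, ∑ i ∈ pairBelow (N P),
        (w * (kap2 a (D P i) * (kap2 b (emb K i) * kap2 d (N P - emb K i)))) • C P := by
  let G : (Fin 3 → Idx K) × (ℕ × ℕ) → M := fun b' =>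
    if b'.1 ∈ S ∧ b'.2 ∈ pairBelow (N b'.1) then
      (w * (kap2 a (D b'.1 b'.2) * (kap2 b (emb K b'.2) * kap2 d (N b'.1 - emb K b'.2)))) • C b'.1
    else 0
  have h1 : ∀ κ, (w * (kap2 a (emb K (κ pair01)) * (kap2 b (emb K (κ pair02)) *
        kap2 d (emb K (κ pair12))))) • C (g κ) = G (g κ, κ pair02) := by
    intro κ
    obtain ⟨e1, e2, e3⟩ := (hg κ (g κ)).1 rfl
    have m2 : κ pair02 ∈ pairBelow (N (g κ)) := mem_pairBelow.2 ⟨_, e2⟩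
    by_cases hC : C (g κ) = 0
    · simp [G, hC]
    · simp only [G]
      rw [if_pos ⟨(hS _).2 ⟨hC, e1⟩, m2⟩, ← e3, ← e2, add_sub_cancel_left]
  have hinj : Function.Injective fun κ : Pairs 3 → ℕ × ℕ => (g κ, κ pair02) := by
    intro κ κ' hk
    obtain ⟨hk1, hk2⟩ := Prod.mk.inj hk
    obtain ⟨-, e2, e3⟩ := (hg κ (g κ)).1 rfl
    obtain ⟨-, e2', e3'⟩ := (hg κ' (g κ)).1 hk1.symm
    refine pairs_three_ext (emb_injective (K := K) ?_) hk2 (emb_injective (K := K) ?_)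
    · rw [e3, e3', hk2]
    · have := e2.trans e2'.symm
      rwa [hk2, add_right_inj] at this
  rw [finsum_congr h1, finsum_comp_of_injective hinj G, finsum_eq_sum_of_support_subset (s :=
    (S ×ˢ S.biUnion fun P => pairBelow (N P)).filter fun b' => b'.2 ∈ pairBelow (N b'.1)),
    Finset.sum_finset_product' _ S (fun P => pairBelow (N P))
      (f := fun P i => G (P, i))]
  · refine Finset.sum_congr rfl fun P hP => Finset.sum_congr rfl fun i hi => ?_
    simp only [G]
    rw [if_pos ⟨hP, hi⟩]
  · rintro ⟨P, i⟩
    simp only [Finset.mem_filter, Finset.mem_product, Finset.mem_biUnion]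
    exact ⟨fun h => ⟨h.1.1, h.2⟩, fun h => ⟨⟨h.1, P, h.1, h.2⟩, h.2⟩⟩
  · rintro ⟨P, i⟩ hPi
    by_cases hc : P ∈ S ∧ i ∈ pairBelow (N P)
    · simp only [Finset.coe_filter, Set.mem_ofPred_eq, Finset.mem_product, Finset.mem_biUnion]
      exact ⟨⟨hc.1, P, hc.1, hc.2⟩, hc.2⟩
    · exact absurd (if_neg hc) hPi
  · rintro ⟨P, i⟩ hno
    by_cases hc : P ∈ S ∧ i ∈ pairBelow (N P)
    · obtain ⟨j, hj⟩ := mem_pairBelow.1 hc.2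
      by_cases hD : kap2 a (D P i) = 0
      · simp [G, hD]
      · obtain ⟨l, hl⟩ := exists_of_kap2_ne hD
        refine absurd ⟨fun q => if q = pair01 then l else if q = pair02 then i else j, ?_⟩ hno
        have n1 : pair02 ≠ pair01 := by decide
        have n2 : pair12 ≠ pair01 := by decide
        have n3 : pair12 ≠ pair02 := by decide
        refine Prod.ext ((hg _ P).2 ⟨((hS P).1 hc.1).2, ?_, ?_⟩) ?_
        · simpa [n1, n2, n3] using hj
        · simpa [n1] using hl
        · simp [n1]
    · exact if_neg hc

lemma pairCoef_eq (a : Idx K) (flip : Bool) (i : ℕ × ℕ) :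
    pairCoef K a flip i = (if flip then sgn a else 1) * kap2 a (emb K i) := by
  rw [pairCoef, kap2_emb, sgn]
  ring

lemma permMul_one_three {C : DistN K M 3} {S : Finset (Fin 3 → Idx K)} {t : Idx K}
    (hh : Pairs 3 → Idx K) (m : Fin 3 → Idx K)
    (hS : ∀ P, P ∈ S ↔ C P ≠ 0 ∧ P 0 + P 1 + P 2 = t)
    (ht : t = m 0 + m 1 + m 2 + hh pair01 + hh pair02 + hh pair12) :
    permMul K M 1 hh C m = ∑ P ∈ S, ∑ i ∈ pairBelow (P 2 - m 2),
      (1 * (kap2 (hh pair01) (m 0 + hh pair01 + hh pair02 - emb K i - P 0) *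
        (kap2 (hh pair02) (emb K i) * kap2 (hh pair12) (P 2 - m 2 - emb K i)))) • C P := by
  have f1 : flipOf (1 : Equiv.Perm (Fin 3)) pair01 = false := by decide
  have f2 : flipOf (1 : Equiv.Perm (Fin 3)) pair02 = false := by decide
  have f3 : flipOf (1 : Equiv.Perm (Fin 3)) pair12 = false := by decide
  rw [← finsum_pairs_three C S t _ _ _ hS (fun P => P 2 - m 2)
    (fun P i => m 0 + hh pair01 + hh pair02 - emb K i - P 0) 1
    (fun κ i => m i + ∑ p : Pairs 3, pairShift K p (hh p) (flipOf 1 p) (κ p) i)]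
  · refine finsum_congr fun κ => ?_
    rw [prod_pairs_three, f1, f2, f3, pairCoef_eq, pairCoef_eq, pairCoef_eq]
    simp
  · intro κ P
    have g0 : m 0 + ∑ p : Pairs 3, pairShift K p (hh p) (flipOf 1 p) (κ p) 0 =
        m 0 + (hh pair01 - emb K (κ pair01)) + (hh pair02 - emb K (κ pair02)) := by
      rw [sum_pairs_three, f1, f2, f3]
      simp [pairShift, pair01, pair02, pair12, emb, Prod.ext_iff, add_assoc]
    have g1 : m 1 + ∑ p : Pairs 3, pairShift K p (hh p) (flipOf 1 p) (κ p) 1 =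
        m 1 + emb K (κ pair01) + (hh pair12 - emb K (κ pair12)) := by
      rw [sum_pairs_three, f1, f2, f3]
      simp [pairShift, pair01, pair02, pair12, emb, Prod.ext_iff, add_assoc]
    have g2 : m 2 + ∑ p : Pairs 3, pairShift K p (hh p) (flipOf 1 p) (κ p) 2 =
        m 2 + emb K (κ pair02) + emb K (κ pair12) := by
      rw [sum_pairs_three, f1, f2, f3]
      simp [pairShift, pair01, pair02, pair12, emb, add_assoc]
    rw [funext_iff, Fin.forall_fin_succ, Fin.forall_fin_succ, Fin.forall_fin_succ]
    simp only [Fin.succ_zero_eq_one, Fin.succ_one_eq_two, IsEmpty.forall_iff, and_true, g0, g1, g2]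
    rw [ht]
    constructor
    · rintro ⟨e0, e1, e2⟩
      refine ⟨?_, ?_, ?_⟩
      · linear_combination -e0 - e1 - e2
      · linear_combination e2
      · linear_combination -e0
    · rintro ⟨e0, e1, e2⟩
      refine ⟨?_, ?_, ?_⟩
      · linear_combination -e2
      · linear_combination -e0 + e2 - e1
      · linear_combination e1

lemma permMul_rot_three {C : DistN K M 3} {S : Finset (Fin 3 → Idx K)} {t : Idx K}
    (hh : Pairs 3 → Idx K) (m : Fin 3 → Idx K)
    (hS : ∀ P, P ∈ S ↔ C P ≠ 0 ∧ P 0 + P 1 + P 2 = t)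
    (ht : t = m 0 + m 1 + m 2 + hh pair01 + hh pair02 + hh pair12) :
    permMul K M rot hh C m =
      ∑ P ∈ S, ∑ i ∈ pairBelow (m 2 + hh pair02 + hh pair12 - P 2),
        (sgn (hh pair02) * sgn (hh pair12) * (kap2 (hh pair01) (m 0 + hh pair01 + emb K i - P 0) *
          (kap2 (hh pair02) (emb K i) *
            kap2 (hh pair12) (m 2 + hh pair02 + hh pair12 - P 2 - emb K i)))) • C P := by
  have f1 : flipOf rot pair01 = false := by decide
  have f2 : flipOf rot pair02 = true := by decide
  have f3 : flipOf rot pair12 = true := by decide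
  rw [← finsum_pairs_three C S t _ _ _ hS (fun P => m 2 + hh pair02 + hh pair12 - P 2)
    (fun P i => m 0 + hh pair01 + emb K i - P 0) _
    (fun κ i => m i + ∑ p : Pairs 3, pairShift K p (hh p) (flipOf rot p) (κ p) i)]
  · refine finsum_congr fun κ => ?_
    rw [prod_pairs_three, f1, f2, f3, pairCoef_eq, pairCoef_eq, pairCoef_eq]
    congr 1
    simp only [if_true, Bool.false_eq_true, if_false]
    ring
  · intro κ P
    have g0 : m 0 + ∑ p : Pairs 3, pairShift K p (hh p) (flipOf rot p) (κ p) 0 =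
        m 0 + (hh pair01 - emb K (κ pair01)) + emb K (κ pair02) := by
      rw [sum_pairs_three, f1, f2, f3]
      simp [pairShift, pair01, pair02, pair12, emb, Prod.ext_iff, add_assoc]
    have g1 : m 1 + ∑ p : Pairs 3, pairShift K p (hh p) (flipOf rot p) (κ p) 1 =
        m 1 + emb K (κ pair01) + emb K (κ pair12) := by
      rw [sum_pairs_three, f1, f2, f3]
      simp [pairShift, pair01, pair02, pair12, emb, add_assoc]
    have g2 : m 2 + ∑ p : Pairs 3, pairShift K p (hh p) (flipOf rot p) (κ p) 2 =
        m 2 + (hh pair02 - emb K (κ pair02)) + (hh pair12 - emb K (κ pair12)) := by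
      rw [sum_pairs_three, f1, f2, f3]
      simp [pairShift, pair01, pair02, pair12, emb, Prod.ext_iff, add_assoc]
    rw [funext_iff, Fin.forall_fin_succ, Fin.forall_fin_succ, Fin.forall_fin_succ]
    simp only [Fin.succ_zero_eq_one, Fin.succ_one_eq_two, IsEmpty.forall_iff, and_true, g0, g1, g2]
    rw [ht]
    constructor
    · rintro ⟨e0, e1, e2⟩
      refine ⟨?_, ?_, ?_⟩
      · linear_combination -e0 - e1 - e2
      · linear_combination -e2
      · linear_combination -e0
    · rintro ⟨e0, e1, e2⟩
      refine ⟨?_, ?_, ?_⟩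
      · linear_combination -e2
      · linear_combination -e0 + e2 + e1
      · linear_combination -e1

/-- Iterated operator product expansion, for a fixed total degree: the expansions of `C` in the
first two variables, for a fixed index `k` of the third one, are replaced by their product with
index `n`, which again expands on both sides of the third variable. -/
lemma InLatN.exists_data {C : DistN K M 3} (hC : InLatN K M C) (hh : Pairs 3 → Idx K)
    (hK : ∀ p, Kbar K (hh p)) (n t : Idx K) :
    ∃ X ∈ KbarExp K M, ∀ k, ∃ F G : Idx K × Idx K →₀ M,
      (∀ m : Fin 3 → Idx K, m 2 = k → m 0 + m 1 + m 2 = t →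
        permMul K M 1 (fun p => -hh p) C m = evalF (cfL (m 0)) F) ∧
      (∀ m : Fin 3 → Idx K, m 2 = k → m 0 + m 1 + m 2 = t →
        permMul K M rot (fun p => -hh p) C m = evalF (cfL (m 0)) G) ∧
      ∀ m, m + k + n = t →
        evalF (cfP n) F = evalF (cfL m) X ∧ evalF (cfP n) G = evalF (cfR m) X := by
  set S := (hC.finite_plane (t - hh pair01 - hh pair02 - hh pair12)).toFinset with hSdef
  have hS : ∀ P, P ∈ S ↔ C P ≠ 0 ∧ P 0 + P 1 + P 2 = t - hh pair01 - hh pair02 - hh pair12 := by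
    intro P
    rw [hSdef, Set.Finite.mem_toFinset]; rfl
  refine ⟨∑ P ∈ S, ∑ j ∈ pairBelow (hh pair01 - 1 - n),
    Finsupp.single (t - n - P 2, hh pair02 + hh pair12 + emb K j)
      ((gchoose K (-hh pair02).1 j.1 * gchoose K (-hh pair02).2 j.2 *
        bin2 (-1 - P 0) (hh pair01 - 1 - n - emb K j)) • C P), ?_, fun k => ?_⟩
  · exact sum_mem fun P _ => sum_mem fun j _ =>
      single_mem_KbarExp (Kbar_add (Kbar_add (hK _) (hK _)) (Kbar_emb j)) _
  refine ⟨∑ P ∈ S, ∑ i ∈ pairBelow (P 2 - k),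
      Finsupp.single (P 0 + hh pair02 + emb K i + hh pair01, hh pair01)
        ((kap2 (-hh pair02) (emb K i) * kap2 (-hh pair12) (P 2 - k - emb K i)) • C P),
    ∑ P ∈ S, ∑ i ∈ pairBelow (k + -hh pair02 + -hh pair12 - P 2),
      Finsupp.single (P 0 - emb K i + hh pair01, hh pair01)
        ((sgn (-hh pair02) * sgn (-hh pair12) * (kap2 (-hh pair02) (emb K i) *
          kap2 (-hh pair12) (k + -hh pair02 + -hh pair12 - P 2 - emb K i))) • C P), ?_, ?_, ?_⟩
  · intro m hm ht
    rw [permMul_one_three _ m hS (by rw [← ht]; ring), hm]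
    simp only [map_sum, evalF_single, smul_smul, cfL]
    refine Finset.sum_congr rfl fun P _ => Finset.sum_congr rfl fun i _ => ?_
    rw [one_mul, show m 0 + -hh pair01 + -hh pair02 - emb K i - P 0 =
      m 0 - (P 0 + hh pair02 + emb K i + hh pair01) by ring]
  · intro m hm ht
    rw [permMul_rot_three _ m hS (by rw [← ht]; ring), hm]
    simp only [map_sum, evalF_single, smul_smul, cfL]
    refine Finset.sum_congr rfl fun P _ => Finset.sum_congr rfl fun i _ => ?_
    rw [show m 0 + -hh pair01 + emb K i - P 0 = m 0 - (P 0 - emb K i + hh pair01) by ring]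
    congr 1
    ring
  · intro m hm
    constructor
    · simp only [map_sum, evalF_single, smul_smul, ← Finset.sum_smul]
      refine Finset.sum_congr rfl fun P _ => ?_
      congr 1
      refine Eq.trans (Finset.sum_congr rfl fun i _ => ?_) ((leibniz_left_pair (-1 - P 0)
        (-hh pair02) (-hh pair12) (hh pair01 - 1 - n) (P 2 - k)).trans
          (Finset.sum_congr rfl fun j _ => ?_))
      · rw [cfP]
        congr 2
        ring
      · rw [cfL, mul_comm]
        congr 2
        · ring
        · rw [← hm]; ring
    · simp only [map_sum, evalF_single, smul_smul, ← Finset.sum_smul]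
      refine Finset.sum_congr rfl fun P _ => ?_
      congr 1
      have e := leibniz_right_pair (-1 - P 0) (-hh pair02) (-hh pair12) (hh pair01 - 1 - n)
        (k + -hh pair02 + -hh pair12 - P 2)
      have e := congrArg (sgn (-hh pair02) * sgn (-hh pair12) * ·) e
      simp only [Finset.mul_sum] at e
      refine Eq.trans (Finset.sum_congr rfl fun i _ => ?_) (e.trans
        (Finset.sum_congr rfl fun j _ => ?_))
      · rw [cfP, show hh pair01 - 1 - (P 0 - emb K i + hh pair01) = -1 - P 0 + emb K i by ring]
        ring
      · have hs : sgn (-(hh pair02 + hh pair12 + emb K j)) =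
            sgn (-hh pair02) * sgn (-hh pair12) * (-1) ^ (j.1 + j.2) := by
          rw [neg_add, neg_add, sgn_add (Kbar_add (Kbar_neg.2 (hK _)) (Kbar_neg.2 (hK _)))
            (Kbar_neg.2 (Kbar_emb j)), sgn_add (Kbar_neg.2 (hK _)) (Kbar_neg.2 (hK _)),
            ← sgn_emb (K := K)]
          congr 1
          have h1 := sgn_add (Kbar_neg.2 (Kbar_emb (K := K) j)) (Kbar_emb j)
          have h2 := sgn_mul_self (Kbar_emb (K := K) j)
          have h3 : sgn (0 : Idx K) = 1 := by
            have := sgn_emb (K := K) 0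
            simpa [emb_zero] using this
          rw [neg_add_cancel, h3] at h1
          linear_combination (- sgn (-emb K j)) * h2 - sgn (emb K j) * h1
        rw [cfR, if_pos (Kbar_add (Kbar_add (hK _) (hK _)) (Kbar_emb j)), hs,
          show t - n - P 2 - (hh pair02 + hh pair12 + emb K j) - m =
            k + -hh pair02 + -hh pair12 - P 2 - emb K j by rw [← hm]; ring,
          show -(hh pair02 + hh pair12 + emb K j) = -hh pair02 + -hh pair12 - emb K j by ring]
        ring

end ThreeVariables

section Vacuum

variable {K : Type*} [Field K] [CharZero K] {V : Type*} [AddCommGroup V] [Module K V]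

/-- the divided power `T^{(i)}` -/
def divPow (T : Module.End K V) (i : ℕ) : Module.End K V := (i.factorial : K)⁻¹ • T ^ i

lemma divPow_mul_self (T : Module.End K V) (i : ℕ) :
    divPow T i * T = ((i : K) + 1) • divPow T (i + 1) := by
  have h : (i : K) + 1 ≠ 0 := by exact_mod_cast i.succ_ne_zero
  rw [divPow, divPow, smul_mul_assoc, ← pow_succ, smul_smul, Nat.factorial_succ]
  congr 1
  push_cast
  field_simp

lemma self_mul_divPow (T : Module.End K V) (i : ℕ) :
    T * divPow T i = ((i : K) + 1) • divPow T (i + 1) := by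
  rw [← divPow_mul_self, divPow, mul_smul_comm, smul_mul_assoc, ← pow_succ', ← pow_succ]

lemma mul_divPow_of_comm (T : Module.End K V) (x : K) (f : ℕ → Module.End K V)
    (hf : ∀ j, f j * T = T * f j + (x - j) • f (j + 1)) (i : ℕ) :
    f 0 * divPow T i =
      ∑ j ∈ Finset.range (i + 1), gchoose K x j • (divPow T (i - j) * f j) := by
  rw [← Finset.Nat.sum_antidiagonal_eq_sum_range_succ
    (fun j r => gchoose K x j • (divPow T r * f j))]
  induction i with
  | zero => simp [gchoose_zero, divPow]
  | succ i ih =>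
    have hi : (i : K) + 1 ≠ 0 := by exact_mod_cast i.succ_ne_zero
    have e1 : ((i : K) + 1) • (f 0 * divPow T (i + 1)) =
        ∑ p ∈ Finset.HasAntidiagonal.antidiagonal i,
          ((gchoose K x p.1 * (p.2 + 1)) • (divPow T (p.2 + 1) * f p.1) +
          (gchoose K x (p.1 + 1) * (p.1 + 1)) • (divPow T p.2 * f (p.1 + 1))) := by
      rw [← mul_smul_comm, ← divPow_mul_self, ← mul_assoc, ih, Finset.sum_mul]
      refine Finset.sum_congr rfl fun p _ => ?_
      have e3 := gchoose_succ x p.1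
      rw [smul_mul_assoc, mul_assoc, hf, mul_add, smul_add, ← mul_assoc, divPow_mul_self,
        smul_mul_assoc, smul_smul, mul_smul_comm, smul_smul]
      congr 2
      linear_combination -e3
    have e2 : ((i : K) + 1) • ∑ p ∈ Finset.HasAntidiagonal.antidiagonal (i + 1),
        gchoose K x p.1 • (divPow T p.2 * f p.1) =
        ∑ p ∈ Finset.HasAntidiagonal.antidiagonal (i + 1),
          (gchoose K x p.1 * p.2) • (divPow T p.2 * f p.1) +
        ∑ p ∈ Finset.HasAntidiagonal.antidiagonal (i + 1),
          (gchoose K x p.1 * p.1) • (divPow T p.2 * f p.1) := by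
      rw [Finset.smul_sum, ← Finset.sum_add_distrib]
      refine Finset.sum_congr rfl fun p hp => ?_
      have hp' : ((p.1 : K) + p.2) = i + 1 := by
        exact_mod_cast Finset.HasAntidiagonal.mem_antidiagonal.1 hp
      rw [smul_smul, ← add_smul, ← hp']
      congr 1
      ring
    refine smul_right_injective _ hi ?_
    simp only
    rw [e1, e2, Finset.Nat.sum_antidiagonal_succ' (n := i),
      Finset.Nat.sum_antidiagonal_succ (n := i), Finset.sum_add_distrib]
    simp

/-- the coefficient of `𝐳 ^ x` in `exp (z T + z̄ T̄)` -/
def texp (T Tb : Module.End K V) (x : Idx K) : Module.End K V :=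
  if h : ∃ i, emb K i = x then divPow T h.choose.1 * divPow Tb h.choose.2 else 0

lemma texp_emb (T Tb : Module.End K V) (i : ℕ × ℕ) :
    texp T Tb (emb K i) = divPow T i.1 * divPow Tb i.2 := by
  have h : ∃ j, emb K j = emb K i := ⟨i, rfl⟩
  rw [texp, dif_pos h, emb_injective h.choose_spec]

omit [CharZero K] in
lemma texp_of_not {T Tb : Module.End K V} {x : Idx K} (h : ¬ ∃ i, emb K i = x) :
    texp T Tb x = 0 :=
  dif_neg h

lemma TransCov.mul_texp {T Tb : Module.End K V} {a : EDist1 K V} (ha : TransCov K V T Tb a)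
    (m x : Idx K) (v : V) :
    a m (texp T Tb x v) = ∑ᶠ l : ℕ × ℕ, (gchoose K m.1 l.1 * gchoose K m.2 l.2) •
      texp T Tb (x - emb K l) (a (m - emb K l) v) := by
  by_cases hx : ∃ i, emb K i = x
  · obtain ⟨i, rfl⟩ := hx
    have h1 : ∀ n : Idx K, ∀ i, a n * divPow T i = ∑ j ∈ Finset.range (i + 1),
        gchoose K n.1 j • (divPow T (i - j) * a (n - emb K (j, 0))) := by
      intro n i
      have := mul_divPow_of_comm T n.1 (fun j => a (n - emb K (j, 0))) (fun j => by
        have h := ha.1 (n - emb K (j, 0))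
        have e : n - emb K (j + 1, 0) =
            ((n - emb K (j, 0)).1 - 1, (n - emb K (j, 0)).2) := by
          ext <;> simp [emb]; ring
        have e' : n.1 - j = (n - emb K (j, 0)).1 := by simp [emb]
        rw [sub_eq_iff_eq_add] at h
        rw [h, e, e', neg_smul]
        abel) i
      have e0 : n - emb K (0, 0) = n := by ext <;> simp [emb]
      simpa only [e0] using this
    have h2 : ∀ n : Idx K, ∀ i, a n * divPow Tb i = ∑ j ∈ Finset.range (i + 1),
        gchoose K n.2 j • (divPow Tb (i - j) * a (n - emb K (0, j))) := by
      intro n i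
      have := mul_divPow_of_comm Tb n.2 (fun j => a (n - emb K (0, j))) (fun j => by
        have h := ha.2 (n - emb K (0, j))
        have e : n - emb K (0, j + 1) =
            ((n - emb K (0, j)).1, (n - emb K (0, j)).2 - 1) := by
          ext <;> simp [emb]; ring
        have e' : n.2 - j = (n - emb K (0, j)).2 := by simp [emb]
        rw [sub_eq_iff_eq_add] at h
        rw [h, e, e', neg_smul]
        abel) i
      have e0 : n - emb K (0, 0) = n := by ext <;> simp [emb]
      simpa only [e0] using this
    rw [finsum_eq_sum_of_support_subset (s := Finset.range (i.1 + 1) ×ˢ Finset.range (i.2 + 1)),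
      Finset.sum_product, ← Module.End.mul_apply, texp_emb, ← mul_assoc, h1, Finset.sum_mul,
      LinearMap.sum_apply]
    · refine Finset.sum_congr rfl fun j hj => ?_
      rw [smul_mul_assoc, mul_assoc, h2, Finset.mul_sum, Finset.smul_sum, LinearMap.sum_apply]
      refine Finset.sum_congr rfl fun j' hj' => ?_
      have e1 : emb K i - emb K (j, j') = emb K (i.1 - j, i.2 - j') := by
        have l1 : j ≤ i.1 := Nat.lt_succ_iff.1 (Finset.mem_range.1 hj)
        have l2 : j' ≤ i.2 := Nat.lt_succ_iff.1 (Finset.mem_range.1 hj')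
        simp [emb, Nat.cast_sub l1, Nat.cast_sub l2]
      have e2 : m - emb K (j, 0) - emb K (0, j') = m - emb K (j, j') := by
        ext <;> simp [emb]
      have e3 : (m - emb K (j, 0)).2 = m.2 := by simp [emb]
      rw [e1, texp_emb, e2, e3, mul_smul_comm, smul_smul, ← mul_assoc]
      rfl
    · intro l hl
      by_contra hl'
      refine hl ?_
      simp only
      rw [texp_of_not, LinearMap.zero_apply, smul_zero]
      rintro ⟨j, hj⟩
      have : j + l = i := emb_injective (K := K) (by rw [emb_add, hj, sub_add_cancel])
      apply hl'
      rw [← this]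
      simp
  · rw [texp_of_not hx, LinearMap.zero_apply, map_zero]
    refine (finsum_eq_zero_of_forall_eq_zero fun l => ?_).symm
    rw [texp_of_not, LinearMap.zero_apply, smul_zero]
    rintro ⟨j, hj⟩
    exact hx ⟨j + l, by rw [emb_add, hj, sub_add_cancel]⟩

variable (A : OPEAlg K V)

lemma OPEAlg.creative (a : V) (m : Idx K) : A.Y a m A.one = texp A.T A.Tb (-1 - m) a := by
  by_cases hm : ∃ i, emb K i = -1 - m
  · obtain ⟨i, hi⟩ := hm
    obtain rfl : m = -1 - emb K i := by rw [hi]; ring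
    rw [sub_sub_cancel, texp_emb]
    have hb : ∀ j : ℕ, A.Y a (-1 - emb K (0, j)) A.one = divPow A.Tb j a := by
      intro j
      induction j with
      | zero =>
        have e : -1 - emb K (0, 0) = ((-1 : K), (-1 : K)) := by ext <;> simp [emb]
        rw [e, A.rid]
        simp [divPow]
      | succ j ih =>
        have h := LinearMap.congr_fun ((A.tcov a).2 (-1 - emb K (0, j))) A.one
        have hj : (j : K) + 1 ≠ 0 := by exact_mod_cast j.succ_ne_zero
        have e : ((-1 - emb K (0, j)).1, (-1 - emb K (0, j)).2 - 1) = -1 - emb K (0, j + 1) := by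
          ext <;> simp [emb]; ring
        have e' : -(-1 - emb K (0, j)).2 = (j : K) + 1 := by simp [emb]
        rw [LinearMap.sub_apply, Module.End.mul_apply, Module.End.mul_apply, A.Tb_one, map_zero,
          sub_zero, ih, LinearMap.smul_apply, e, e', ← Module.End.mul_apply, self_mul_divPow,
          LinearMap.smul_apply] at h
        exact (smul_right_injective _ hj h).symm
    obtain ⟨i, j⟩ := i
    clear hi
    induction i with
    | zero => rw [hb]; simp [divPow]
    | succ i ih =>
      have h := LinearMap.congr_fun ((A.tcov a).1 (-1 - emb K (i, j))) A.one
      have hj : (i : K) + 1 ≠ 0 := by exact_mod_cast i.succ_ne_zero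
      have e : ((-1 - emb K (i, j)).1 - 1, (-1 - emb K (i, j)).2) = -1 - emb K (i + 1, j) := by
        ext <;> simp [emb]; ring
      have e' : -(-1 - emb K (i, j)).1 = (i : K) + 1 := by simp [emb]
      rw [LinearMap.sub_apply, Module.End.mul_apply, Module.End.mul_apply, A.T_one, map_zero,
        sub_zero, ih, LinearMap.smul_apply, e, e', ← Module.End.mul_apply, ← mul_assoc,
        self_mul_divPow, smul_mul_assoc, LinearMap.smul_apply] at h
      exact (smul_right_injective _ hj h).symm
  · rw [texp_of_not hm, LinearMap.zero_apply]
    by_contra hne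
    obtain ⟨i, hi⟩ := isNegInt_iff.1 (A.wcre a m hne)
    exact hm ⟨i, by rw [hi]; ring⟩

lemma OPEAlg.exists_vacuum_data {a b : V} {pa pb : ZMod 2} (ha : memPar K A.ev A.od a pa)
    (hb : memPar K A.ev A.od b pb) (s : Idx K) :
    ∃ D : Idx K × Idx K →₀ V,
      (∀ m k, m + k = s → A.Y a m (A.Y b k A.one) = evalF (cfL m) D) ∧
      ∀ n k, n + k = s → A.Y (A.Y a n b) k A.one = evalF (cfP n) D := by
  have hfin : {p | A.Y a p b ≠ 0 ∧ ∃ j, emb K j = p - (1 + s)}.Finite := by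
    obtain ⟨r, c, h, -, h2, h3, -⟩ := A.loc a b pa pb ha hb
    refine (Set.finite_iUnion fun i : Fin r =>
      (h2 i A.one).finite_zwPow (-(h i)) (-1, -1) (1 + s)).subset ?_
    rintro p ⟨hp, hj⟩
    rw [← A.rid b, h3] at hp
    obtain ⟨i, -, hi⟩ := Finset.exists_ne_zero_of_sum_ne_zero hp
    exact Set.mem_iUnion.2 ⟨i, hi, hj⟩
  let g : Idx K → (Idx K × Idx K →₀ V) := fun p =>
    Finsupp.single (p, p + 1) (texp A.T A.Tb (p - (1 + s)) (A.Y a p b))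
  have hg : (Function.support g).Finite := by
    refine hfin.subset fun p hp => ⟨fun h0 => hp ?_, ?_⟩
    · simp [g, h0]
    · by_contra hj
      refine hp ?_
      simp [g, texp_of_not hj]
  have hD : ∀ φ : Idx K → Idx K → K, evalF φ (∑ᶠ p, g p) =
      ∑ᶠ p, φ p (p + 1) • texp A.T A.Tb (p - (1 + s)) (A.Y a p b) := by
    intro φ
    rw [← LinearMap.toAddMonoidHom_coe, AddMonoidHom.map_finsum _ hg]
    exact finsum_congr fun p => evalF_single φ _ _ _
  refine ⟨∑ᶠ p, g p, ?_, ?_⟩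
  · rintro m k rfl
    rw [hD, A.creative b, (A.tcov a).mul_texp,
      ← finsum_comp_of_injective (g := fun l => m - emb K l)]
    · refine finsum_congr fun l => ?_
      congr 1
      · rw [cfL, sub_sub_cancel, kap2]
        have e1 := kap_neg_sub_one m.1 l.1
        have e2 := kap_neg_sub_one m.2 l.2
        rw [← e1, ← e2]
        congr 2
        · simp [emb]; ring
        · simp [emb]; ring
      · congr 2
        ring
    · intro i j hij
      exact emb_injective (sub_right_injective hij)
    · intro p hp
      rw [cfL]
      by_cases h0 : kap2 (-(p + 1)) (m - p) = 0
      · rw [h0, zero_smul]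
      · obtain ⟨i, hi⟩ := exists_of_kap2_ne h0
        exact absurd ⟨i, by rw [hi]; ring⟩ hp
  · rintro n k rfl
    rw [hD, A.creative, finsum_eq_single _ n]
    · rw [cfP, show n + 1 - 1 - n = 0 by ring, bin2_zero_left, if_pos rfl, one_smul]
      congr 2
      ring
    · intro p hp
      rw [cfP, show p + 1 - 1 - p = 0 by ring, bin2_zero_left, if_neg, zero_smul]
      intro h0
      exact hp (by linear_combination h0)

end Vacuum

section Main

variable {K : Type*} [Field K] [CharZero K] {V : Type*} [AddCommGroup V] [Module K V]

lemma koszulPerm_one_three (ps : Fin 3 → ZMod 2) : koszulPerm K ps 1 = 1 := by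
  refine Finset.prod_eq_one fun p _ => if_neg fun h => ?_
  exact absurd h.1 (not_lt.2 p.2.le)

lemma koszulPerm_rot (ps : Fin 3 → ZMod 2) :
    koszulPerm K ps rot = koszul K (ps 0 + ps 1) (ps 2) := by
  have f1 : ¬ rot.symm pair01.1.2 < rot.symm pair01.1.1 := by decide
  have f2 : rot.symm pair02.1.2 < rot.symm pair02.1.1 := by decide
  have f3 : rot.symm pair12.1.2 < rot.symm pair12.1.1 := by decide
  rw [koszulPerm, prod_pairs_three]
  simp only [f1, f2, f3, false_and, true_and, if_false, one_mul]
  simp only [koszul, pair02, pair12]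
  have h01 : (0 : ZMod 2) ≠ 1 := by decide
  have h11 : (1 + 1 : ZMod 2) = 0 := by decide
  have hcases : ∀ p : ZMod 2, p = 0 ∨ p = 1 := by decide
  rcases hcases (ps 0) with h0 | h0 <;> rcases hcases (ps 1) with h1 | h1 <;>
    rcases hcases (ps 2) with h2 | h2 <;> simp [h0, h1, h2, h01, h11]

lemma MultiplyLocal.exists_data {f : Fin 3 → EDist1 K V} {ps : Fin 3 → ZMod 2}
    (H : MultiplyLocal K V f ps) (v : V) (n t : Idx K) :
    ∃ X ∈ KbarExp K V, ∀ k, ∃ F G : Idx K × Idx K →₀ V,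
      (∀ m l, m + l + k = t → f 0 m (f 1 l (f 2 k v)) = evalF (cfL m) F) ∧
      (∀ m l, m + l + k = t →
        koszul K (ps 0 + ps 1) (ps 2) • f 2 k (f 0 m (f 1 l v)) = evalF (cfL m) G) ∧
      ∀ m, m + k + n = t →
        evalF (cfP n) F = evalF (cfL m) X ∧ evalF (cfP n) G = evalF (cfR m) X := by
  obtain ⟨rij, hs, c, hK, hC, hperm⟩ := H
  choose X hX hdata using fun α => (hC α v).exists_data
    (fun p => hs p.1.1 p.1.2 (α p)) (fun p => hK _ _ _) n t
  choose F G h1 h2 h3 using hdata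
  refine ⟨∑ α, X α, sum_mem fun α _ => hX α, fun k =>
    ⟨∑ α, F α k, ∑ α, G α k, fun m l hm => ?_, fun m l hm => ?_, fun m hm => ⟨?_, ?_⟩⟩⟩
  · have h := hperm 1 v ![m, l, k]
    rw [koszulPerm_one_three, one_smul] at h
    rw [map_sum]
    refine Eq.trans ?_ (h.trans (Finset.sum_congr rfl fun α _ => h1 α k ![m, l, k] rfl hm))
    simp [compSeq, List.ofFn_succ]
  · have h := hperm rot v ![m, l, k]
    rw [koszulPerm_rot] at h
    rw [map_sum]
    refine Eq.trans ?_ (h.trans (Finset.sum_congr rfl fun α _ => h2 α k ![m, l, k] rfl hm))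
    simp [compSeq, List.ofFn_succ, rot]
  · rw [map_sum, map_sum]
    exact Finset.sum_congr rfl fun α _ => (h3 α k m hm).1
  · rw [map_sum, map_sum]
    exact Finset.sum_congr rfl fun α _ => (h3 α k m hm).2

variable (A : OPEAlg K V)

omit [CharZero K] in
lemma exists_homogeneous_add {ev od : Submodule K V} (h : IsCompl ev od) (x : V) :
    ∃ y z, memPar K ev od y 0 ∧ memPar K ev od z 1 ∧ y + z = x := by
  obtain ⟨y, hy, z, hz, e⟩ := Submodule.mem_sup.1 (h.sup_eq_top ▸ Submodule.mem_top (x := x))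
  exact ⟨y, z, Or.inl ⟨rfl, hy⟩, Or.inr ⟨rfl, hz⟩, e⟩

lemma OPEAlg.product_apply_homogeneous (hml : MultLocalAlg K V A) {a b x : V}
    {pa pb px : ZMod 2} (ha : memPar K A.ev A.od a pa) (hb : memPar K A.ev A.od b pb)
    (hx : memPar K A.ev A.od x px) {r : ℕ} {c : Fin r → EDist2 K V} {h : Fin r → Idx K}
    (H : IsOPE K V pa pb (A.Y a) (A.Y b) c h) (n m : Idx K) :
    A.Y (A.Y a n b) m x = prodAt K V c h n x m := by
  have hpar : ∀ i, memPar K A.ev A.od ((![a, b, x] : Fin 3 → V) i)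
      ((![pa, pb, px] : Fin 3 → ZMod 2) i) := by
    intro i
    fin_cases i
    · exact ha
    · exact hb
    · exact hx
  obtain ⟨X, hX, hdata⟩ := (hml 3 ![a, b, x] ![pa, pb, px] hpar).exists_data A.one n
    (m + -1 + n)
  obtain ⟨r', c', h', H'⟩ := A.loc _ x _ px (A.Y_par a pa ha n b pb hb) hx
  obtain ⟨Z, hZ, hZL, hZR, -⟩ := H'.exists_data A.one (m + -1)
  have hR : ∀ m', evalF (cfR m') X = evalF (cfR m') Z := by
    intro m'
    obtain ⟨F, G, -, hG, hXG⟩ := hdata (m - 1 - m')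
    obtain ⟨D, hD1, hD2⟩ := A.exists_vacuum_data ha hb (m' + n)
    have e : evalF (cfP n) G = evalF (cfP n) (Finsupp.mapRange.linearMap
        (koszul K (pa + pb) px • A.Y x (m - 1 - m')) D) := by
      refine evalF_eq_of_cfL (compat_cfP n) fun m0 => ?_
      rw [evalF_map, ← hD1 m0 (m' + n - m0) (by ring)]
      exact (hG m0 (m' + n - m0) (by ring)).symm
    rw [← (hXG m' (by ring)).2, e, evalF_map, ← hD2 n m' (by ring),
      ← hZR m' (m - 1 - m') (by ring)]
    rfl
  have hL := evalF_cfL_eq_of_cfR hX hZ hR m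
  rw [← hZL m (-1, -1) rfl, A.rid] at hL
  obtain ⟨F, G, hF, -, hXF⟩ := hdata (-1, -1)
  obtain ⟨W, -, hW, -, hWP⟩ := H.exists_data x (m + n)
  rw [← hL, ← (hXF m rfl).1, hWP n m (add_comm n m)]
  refine evalF_eq_of_cfL (compat_cfP n) fun m0 => ?_
  rw [← hW m0 (m + n - m0) (by ring), ← hF m0 (m + n - m0)
    (by rw [add_sub_cancel]; exact add_right_comm _ _ _)]
  exact congrArg (fun u => A.Y a m0 (A.Y b (m + n - m0) u)) (A.rid x)

lemma IsOPE.prodAt_add {pa pb : ZMod 2} {a b : EDist1 K V} {r : ℕ}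
    {c : Fin r → EDist2 K V} {h : Fin r → Idx K} (H : IsOPE K V pa pb a b c h)
    (n m : Idx K) (v w : V) :
    prodAt K V c h n (v + w) m = prodAt K V c h n v m + prodAt K V c h n w m := by
  obtain ⟨X, -, hX, -, hXP⟩ := H.exists_data v (n + m)
  obtain ⟨Y, -, hY, -, hYP⟩ := H.exists_data w (n + m)
  obtain ⟨Z, -, hZ, -, hZP⟩ := H.exists_data (v + w) (n + m)
  rw [hXP n m rfl, hYP n m rfl, hZP n m rfl, ← map_add]
  refine evalF_eq_of_cfL (compat_cfP n) fun l => ?_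
  rw [map_add, ← hX l (n + m - l) (by ring), ← hY l (n + m - l) (by ring),
    ← hZ l (n + m - l) (by ring), map_add, map_add]

lemma OPEAlg.product_apply (hml : MultLocalAlg K V A) {a b : V} {pa pb : ZMod 2}
    (ha : memPar K A.ev A.od a pa) (hb : memPar K A.ev A.od b pb)
    {r : ℕ} {c : Fin r → EDist2 K V} {h : Fin r → Idx K}
    (H : IsOPE K V pa pb (A.Y a) (A.Y b) c h) (n m : Idx K) (x : V) :
    A.Y (A.Y a n b) m x = prodAt K V c h n x m := by
  obtain ⟨y, z, hy, hz, rfl⟩ := exists_homogeneous_add A.compl x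
  rw [map_add, H.prodAt_add, A.product_apply_homogeneous hml ha hb hy H,
    A.product_apply_homogeneous hml ha hb hz H]

lemma OPEAlg.one_apply_one (m : Idx K) : A.Y A.one m A.one = if m = -1 then A.one else 0 := by
  rw [A.creative]
  by_cases hm : ∃ i, emb K i = -1 - m
  · obtain ⟨⟨i, j⟩, hi⟩ := hm
    rw [← hi, texp_emb]
    have hT : ∀ i : ℕ, divPow A.T i A.one = if i = 0 then A.one else 0 := by
      rintro (_ | i)
      · simp [divPow]
      · simp [divPow, pow_succ, A.T_one]
    have hTb : ∀ i : ℕ, divPow A.Tb i A.one = if i = 0 then A.one else 0 := by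
      rintro (_ | i)
      · simp [divPow]
      · simp [divPow, pow_succ, A.Tb_one]
    have e : m = -1 ↔ i = 0 ∧ j = 0 := by
      have h0 : m = -1 ↔ emb K (i, j) = 0 := by
        rw [hi, sub_eq_zero, eq_comm]
      rw [h0]
      simp [emb, Prod.ext_iff]
    rw [Module.End.mul_apply, hTb]
    by_cases hj : j = 0
    · simp [hj, hT, e]
    · simp [hj, e]
  · rw [texp_of_not hm, if_neg, LinearMap.zero_apply]
    rintro rfl
    exact hm ⟨0, by rw [emb_zero]; ring⟩

lemma OPEAlg.one_apply_homogeneous {x : V} {px : ZMod 2} (hx : memPar K A.ev A.od x px)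
    (m : Idx K) : A.Y A.one m x = if m = -1 then x else 0 := by
  obtain ⟨r, c, h, H⟩ := A.loc A.one x 0 px (Or.inl ⟨rfl, A.one_ev⟩) hx
  obtain ⟨Z, hZ, hZL, hZR, -⟩ := H.exists_data A.one (m + -1)
  have hK0 : Kbar K (0 : Idx K) := ⟨0, by simp⟩
  have hs0 : sgn (-0 : Idx K) = 1 := by
    have := sgn_emb (K := K) 0
    simpa [emb_zero] using this
  have hR : ∀ m', evalF (cfR m') (Finsupp.single ((-1, 0) : Idx K × Idx K) (A.Y x m A.one)) =
      evalF (cfR m') Z := by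
    intro m'
    have hkz : koszul K 0 px = 1 := if_neg fun h => absurd h.1 (by decide)
    rw [← hZR m' (m + -1 - m') (by ring), evalF_single, cfR, if_pos hK0, A.one_apply_one, hkz,
      one_smul, hs0, one_mul, neg_zero, kap2_zero_left, sub_zero]
    by_cases hm' : m' = -1
    · subst hm'
      simp
    · rw [if_neg (fun h => hm' (by linear_combination -h)), if_neg hm', zero_smul, map_zero]
  have hL := evalF_cfL_eq_of_cfR (single_mem_KbarExp hK0 _) hZ hR m
  rw [← hZL m (-1, -1) rfl, A.rid, evalF_single, cfL, neg_zero, kap2_zero_left] at hL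
  rw [← hL]
  by_cases hm : m = -1
  · subst hm
    rw [if_pos rfl, if_pos (sub_self _), one_smul]
    exact A.rid x
  · rw [if_neg hm, if_neg (fun h => hm (sub_eq_zero.1 h)), zero_smul]

lemma OPEAlg.Y_one : A.Y A.one = idField K V := by
  funext m
  refine LinearMap.ext fun x => ?_
  obtain ⟨y, z, hy, hz, rfl⟩ := exists_homogeneous_add A.compl x
  rw [map_add, A.one_apply_homogeneous hy, A.one_apply_homogeneous hz]
  change _ = (if m = -1 then (1 : Module.End K V) else 0) (y + z)
  by_cases hm : m = -1
  · simp [hm]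
  · simp [hm]

end Main

/-- for a multiply local OPE-algebra, F_Y is closed under the
products of fields and Y is an isomorphism of OPE-algebras onto F_Y. -/
theorem stmt_9 (K : Type*) [Field K] [CharZero K]
    (V : Type*) [AddCommGroup V] [Module K V]
    (A : OPEAlg K V) (hml : MultLocalAlg K V A) :
    (∀ (a b : V) (pa pb : ZMod 2), memPar K A.ev A.od a pa → memPar K A.ev A.od b pb →
      ∀ {r : ℕ} (c : Fin r → EDist2 K V) (h : Fin r → Idx K),
        IsOPE K V pa pb (A.Y a) (A.Y b) c h →
        ∀ (n : Idx K) (v : V) (m : Idx K),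
          A.Y (A.Y a n b) m v = prodAt K V c h n v m) ∧
    Function.Injective (fun a : V => A.Y a) ∧
    (∀ a : V, A.Y a ((-1 : K), (-1 : K)) A.one = a) ∧
    A.Y A.one = idField K V := by
  refine ⟨fun a b pa pb ha hb r c h H n v m => A.product_apply hml ha hb H n m v,
    fun a b hab => ?_, A.rid, A.Y_one⟩
  rw [← A.rid a, ← A.rid b]
  exact congrArg (fun f : EDist1 K V => f (-1, -1) A.one) hab

end OPEA
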